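/- arXiv:0808.2910 — 3 statements merged into one kernel-verified Lean document; each statement's English description precedes it below -/
import Mathlib

section
/- Let K be an infinite field and X ⊂ P^{n-1}_K a complete intersection of degree d and dimension m, with σ = dim Sing X. Then there exists a linear subspace L ⊆ P^{n-1}_K of codimension σ+1 such that X ∩ L is non-singular of degree d and dimension m − σ − 1. -/
open MvPolynomial

noncomputable section

/-- The zero locus in `K^n` of a set of polynomials. -/
def zeroLocusSet {K : Type*} [Field K] {n : ℕ} (S : Set (MvPolynomial (Fin n) K)) :
    Set (Fin n → K) := {x | ∀ f ∈ S, eval x f = 0}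

/-- The vanishing ideal of a set of points of `K^n`. -/
def vIdeal {K : Type*} [Field K] {n : ℕ} (S : Set (Fin n → K)) :
    Ideal (MvPolynomial (Fin n) K) where
  carrier := {f | ∀ x ∈ S, eval x f = 0}
  add_mem' := by intro a b ha hb x hx; simp [ha x hx, hb x hx]
  zero_mem' := by intro x hx; simp
  smul_mem' := by intro c f hf x hx; simp [smul_eq_mul, hf x hx]

/-- Dimension of (the Zariski closure of) a subset of `K^n`, as the Krull
dimension of its affine coordinate ring. -/
def coneDim {K : Type*} [Field K] {n : ℕ} (S : Set (Fin n → K)) : WithBot ℕ∞ :=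
  ringKrullDim (MvPolynomial (Fin n) K ⧸ vIdeal S)

/-- An `r×r` minor of the Jacobian matrix of a system of `r` polynomials,
given by a choice `c` of `r` columns. -/
def jacMinor {K : Type*} [Field K] {n r : ℕ} (f : Fin r → MvPolynomial (Fin n) K)
    (c : Fin r → Fin n) : MvPolynomial (Fin n) K :=
  (Matrix.of fun i j => pderiv (c j) (f i)).det

/-- The ideal of the singular locus (Jacobian criterion) of the system `f`. -/
def singIdeal {K : Type*} [Field K] {n r : ℕ} (f : Fin r → MvPolynomial (Fin n) K) :
    Ideal (MvPolynomial (Fin n) K) :=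
  Ideal.span (Set.range f ∪ Set.range (jacMinor f))

/-- The projective scheme cut out by the system `f` is non-singular: any prime
containing the singular ideal contains the irrelevant ideal. -/
def ProjNonsingular {K : Type*} [Field K] {n r : ℕ} (f : Fin r → MvPolynomial (Fin n) K) :
    Prop :=
  ∀ P : Ideal (MvPolynomial (Fin n) K), P.IsPrime → singIdeal f ≤ P →
    ∀ i, MvPolynomial.X i ∈ P

/-- The directional derivative polynomial `G^y = y · ∇G`. -/
def polY {K : Type*} [Field K] {n : ℕ} (y : Fin n → K) (G : MvPolynomial (Fin n) K) :
    MvPolynomial (Fin n) K :=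
  ∑ i, C (y i) * pderiv i G

end

universe u

/-- If every prime containing `J` is maximal or strictly contains a prime containing `I`, then
`dim R/J` is smaller than `dim R/I`, or zero. -/
lemma ringKrullDim_quotient_le_of_forall_isPrime {R : Type*} [CommRing R] {I J : Ideal R} {u : ℕ}
    (hI : ringKrullDim (R ⧸ I) ≤ ((u + 1 : ℕ) : WithBot ℕ∞))
    (h : ∀ P : Ideal R, P.IsPrime → J ≤ P →
      P.IsMaximal ∨ ∃ Q : Ideal R, Q.IsPrime ∧ I ≤ Q ∧ Q < P) :
    ringKrullDim (R ⧸ J) ≤ (u : WithBot ℕ∞) := by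
  rw [ringKrullDim_quotient] at hI ⊢
  refine iSup_le fun p => ?_
  rcases h p.head.1.asIdeal p.head.1.isPrime p.head.2 with hmax | ⟨Q, hQ, hIQ, hlt⟩
  · have hlen : p.length = 0 := by
      by_contra hne
      have hlt : p.head < p.last := by
        have : NeZero p.length := ⟨hne⟩
        exact p.strictMono (Fin.last_pos')
      have hlt' : p.head.1.asIdeal < p.last.1.asIdeal := hlt
      exact p.last.1.isPrime.ne_top (hmax.1.2 _ hlt')
    rw [hlen]
    exact_mod_cast Nat.zero_le u
  · have hsub : ∀ x : PrimeSpectrum.zeroLocus (R := R) J, p.head ≤ x →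
        x.1 ∈ PrimeSpectrum.zeroLocus (R := R) I := fun x hx =>
      hIQ.trans (hlt.le.trans hx)
    let q : LTSeries (PrimeSpectrum.zeroLocus (R := R) I) :=
      { length := p.length
        toFun := fun i => ⟨(p i).1, hsub _ (LTSeries.head_le p i)⟩
        step := fun i => p.step i }
    have hhead : (⟨⟨Q, hQ⟩, hIQ⟩ : PrimeSpectrum.zeroLocus (R := R) I) < q.head := hlt
    have := (Order.LTSeries.length_le_krullDim (q.cons _ hhead)).trans hI
    have h2 : (q.cons _ hhead).length = p.length + 1 := by simp [q]
    rw [h2] at this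
    have h3 : p.length + 1 ≤ u + 1 := by exact_mod_cast this
    exact_mod_cast Nat.le_of_succ_le_succ h3

/-- An integral extension has at least the Krull dimension of the base. -/
lemma ringKrullDim_le_of_isIntegral_of_injective {R S : Type*} [CommRing R] [CommRing S]
    [Algebra R S] [Algebra.IsIntegral R S] (hinj : Function.Injective (algebraMap R S)) :
    ringKrullDim R ≤ ringKrullDim S := by
  refine iSup_le fun l => ?_
  obtain ⟨P, -, hP, hPl⟩ := Ideal.exists_ideal_over_prime_of_isIntegral (S := S)
    l.head.asIdeal ⊥ (by
      intro x hx
      have : algebraMap R S x = 0 := hx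
      rw [(injective_iff_map_eq_zero _).1 hinj x this]
      exact zero_mem _)
  have : P.LiesOver l.head.asIdeal := ⟨hPl.symm⟩
  obtain ⟨L, hL, -⟩ := Ideal.exists_ltSeries_of_hasGoingUp l P
  rw [← hL]
  exact Order.LTSeries.length_le_krullDim L

/-- Polynomial rings in more variables than the dimension do not embed. -/
lemma not_injective_of_ringKrullDim_lt {K A : Type*} [Field K] [CommRing A] [Algebra K A]
    [Algebra.FiniteType K A] {n : ℕ} (hA : ringKrullDim A < (n : WithBot ℕ∞))
    (φ : MvPolynomial (Fin n) K →ₐ[K] A) : ¬ Function.Injective φ := by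
  intro hφ
  have hker : (⊥ : Ideal A).comap (φ : MvPolynomial (Fin n) K →+* A) = ⊥ :=
    (RingHom.injective_iff_ker_eq_bot _).1 hφ
  obtain ⟨P, hP, hcomap⟩ := Ideal.exists_minimalPrimes_comap_eq
    (I := (⊥ : Ideal A)) (φ : MvPolynomial (Fin n) K →+* A) ⊥ (by
      rw [hker, Ideal.minimalPrimes_eq_subsingleton_self]
      exact rfl)
  have := hP.1.1
  let ψ : MvPolynomial (Fin n) K →ₐ[K] A ⧸ P := (Ideal.Quotient.mkₐ K P).comp φ
  have hψ : Function.Injective ψ := by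
    refine (injective_iff_map_eq_zero _).2 fun x hx => ?_
    have hx' : φ x ∈ P := Ideal.Quotient.eq_zero_iff_mem.1 hx
    have : x ∈ P.comap (φ : MvPolynomial (Fin n) K →+* A) := hx'
    rw [hcomap] at this
    exact this
  obtain ⟨s, g, hg, hint⟩ := exists_integral_inj_algHom_of_fg K (A ⧸ P)
  let : Algebra (MvPolynomial (Fin s) K) (A ⧸ P) := g.toRingHom.toAlgebra
  have : IsScalarTower K (MvPolynomial (Fin s) K) (A ⧸ P) :=
    IsScalarTower.of_algHom g
  have : Algebra.IsIntegral (MvPolynomial (Fin s) K) (A ⧸ P) := ⟨hint⟩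
  have hs : (s : WithBot ℕ∞) ≤ ringKrullDim A := by
    have h1 := ringKrullDim_le_of_isIntegral_of_injective
      (R := MvPolynomial (Fin s) K) (S := A ⧸ P) hg
    rw [MvPolynomial.ringKrullDim_of_isNoetherianRing, ringKrullDim_eq_zero_of_field] at h1
    simp only [Nat.card_eq_fintype_card, Fintype.card_fin, zero_add] at h1
    exact h1.trans (ringKrullDim_quotient_le P)
  have hlt : s < n := by exact_mod_cast hs.trans_lt hA
  have : FaithfulSMul (MvPolynomial (Fin s) K) (A ⧸ P) :=
    (faithfulSMul_iff_algebraMap_injective _ _).2 hg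
  have htr := lift_trdeg_add_eq K (MvPolynomial (Fin s) K) (A ⧸ P)
  have hle := lift_trdeg_le_of_injective ψ hψ
  rw [← htr, trdeg_eq_zero (R := MvPolynomial (Fin s) K) (A := A ⧸ P)] at hle
  simp only [MvPolynomial.trdeg_of_isDomain, Cardinal.mk_fin, Cardinal.lift_natCast,
    Cardinal.lift_zero, add_zero, Nat.cast_le] at hle
  omega

attribute [local instance] MvPolynomial.gradedAlgebra

lemma ker_constantCoeff_le_of_X_mem {σ R : Type*} [CommRing R] {P : Ideal (MvPolynomial σ R)}
    (hX : ∀ i, (X i : MvPolynomial σ R) ∈ P) :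
    RingHom.ker (constantCoeff : MvPolynomial σ R →+* R) ≤ P := by
  intro p hp
  have hhom : (Ideal.Quotient.mk P).comp (C.comp constantCoeff) = Ideal.Quotient.mk P := by
    refine MvPolynomial.ringHom_ext (fun r => by simp) fun i => ?_
    simpa using ((Ideal.Quotient.eq_zero_iff_mem).2 (hX i)).symm
  have h0 : constantCoeff p = 0 := hp
  have := congrArg (fun g => g p) hhom
  rw [← Ideal.Quotient.eq_zero_iff_mem]
  simpa [h0] using this.symm

lemma isMaximal_of_X_mem {σ K : Type*} [Field K] {P : Ideal (MvPolynomial σ K)} (hP : P.IsPrime)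
    (hX : ∀ i, (X i : MvPolynomial σ K) ∈ P) : P.IsMaximal := by
  have hmax : (RingHom.ker (constantCoeff : MvPolynomial σ K →+* K)).IsMaximal :=
    RingHom.ker_isMaximal_of_surjective _ fun a => ⟨C a, constantCoeff_C _ a⟩
  rw [← hmax.eq_of_le hP.ne_top (ker_constantCoeff_le_of_X_mem hX)]
  exact hmax

/-- The irrelevant ideal of a polynomial ring in `n` variables has height at least `n`. -/
lemma le_height_ker_constantCoeff {K : Type*} [Field K] (n : ℕ) :
    (n : ℕ∞) ≤ (RingHom.ker (constantCoeff : MvPolynomial (Fin n) K →+* K)).height := by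
  let φ : ℕ → MvPolynomial (Fin n) K →ₐ[K] MvPolynomial (Fin n) K := fun i =>
    aeval fun j => if (j : ℕ) < i then 0 else X j
  have hφ : ∀ i, (φ (i + 1)).comp (φ i) = φ (i + 1) := by
    intro i
    refine MvPolynomial.algHom_ext fun j => ?_
    by_cases hj : (j : ℕ) < i
    · simp [φ, hj, hj.le]
    · simp [φ, hj]
  have hcc : ∀ i p, constantCoeff (φ i p) = constantCoeff p := by
    intro i p
    have : (constantCoeff : MvPolynomial (Fin n) K →+* K).comp (φ i).toRingHom
        = constantCoeff := by
      refine MvPolynomial.ringHom_ext (fun r => by simp [φ]) fun j => ?_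
      by_cases hj : (j : ℕ) < i <;> simp [φ, hj]
    exact congrArg (fun g => g p) this
  let q : LTSeries (PrimeSpectrum (MvPolynomial (Fin n) K)) :=
    { length := n
      toFun := fun i => ⟨RingHom.ker (φ i).toRingHom, RingHom.ker_isPrime _⟩
      step := fun i => by
        change RingHom.ker (φ i).toRingHom < RingHom.ker (φ (i + 1)).toRingHom
        refine lt_of_le_of_ne (fun p hp => ?_) fun heq => ?_
        · have hp' : φ i p = 0 := hp
          change φ (i + 1) p = 0
          rw [← hφ i, AlgHom.comp_apply, hp', map_zero]
        · have hmem : (X i : MvPolynomial (Fin n) K) ∈ RingHom.ker (φ (i + 1)).toRingHom := by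
            change φ (i + 1) (X i) = 0
            simp [φ]
          rw [← heq] at hmem
          have : φ i (X i) = 0 := hmem
          simp [φ] at this }
  let m : PrimeSpectrum (MvPolynomial (Fin n) K) :=
    ⟨RingHom.ker (constantCoeff : MvPolynomial (Fin n) K →+* K), RingHom.ker_isPrime _⟩
  change (n : ℕ∞) ≤ m.asIdeal.height
  rw [PrimeSpectrum.height_eq_orderHeight]
  refine Order.length_le_height (p := q) fun p hp => ?_
  have hp' : φ n p = 0 := hp
  change constantCoeff p = 0
  rw [← hcc n, hp', map_zero]

/-- Forms without constant term cut out a locus of at least the expected dimension. -/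
lemma le_ringKrullDim_quotient_span_range_add {K : Type*} [Field K] {n s : ℕ}
    {F : Fin s → MvPolynomial (Fin n) K} (hF : ∀ i, constantCoeff (F i) = 0) :
    (n : WithBot ℕ∞) ≤
      ringKrullDim (MvPolynomial (Fin n) K ⧸ Ideal.span (Set.range F)) + (s : WithBot ℕ∞) := by
  have hprime : (RingHom.ker (constantCoeff : MvPolynomial (Fin n) K →+* K)).IsPrime :=
    RingHom.ker_isPrime _
  have h1 := Ideal.height_le_ringKrullDim_quotient_add_encard
    (p := RingHom.ker (constantCoeff : MvPolynomial (Fin n) K →+* K)) (Set.range F)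
    (by rintro _ ⟨i, rfl⟩; exact hF i)
  have h2 : (Set.range F).encard ≤ s := by
    rw [← Set.image_univ]
    refine (Set.encard_image_le _ _).trans ?_
    simp
  refine le_trans ?_ (h1.trans ?_)
  · exact_mod_cast le_height_ker_constantCoeff n
  · gcongr
    exact_mod_cast h2

/-- Every prime over a homogeneous ideal contains one that lies in the irrelevant ideal. -/
lemma exists_isPrime_le_ker_constantCoeff {σ K : Type*} [Field K]
    {I P : Ideal (MvPolynomial σ K)} (hI : I.IsHomogeneous (homogeneousSubmodule σ K))
    (hP : P.IsPrime) (hIP : I ≤ P) :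
    ∃ Q : Ideal (MvPolynomial σ K), Q.IsPrime ∧ I ≤ Q ∧ Q ≤ P ∧
      Q ≤ RingHom.ker (constantCoeff : MvPolynomial σ K →+* K) := by
  refine ⟨(P.homogeneousCore (homogeneousSubmodule σ K)).toIdeal, hP.homogeneousCore, ?_,
    Ideal.toIdeal_homogeneousCore_le _ _, ?_⟩
  · rw [← hI.toIdeal_homogeneousCore_eq_self]
    exact Ideal.homogeneousCore_mono _ hIP
  · intro p hp
    have h0 := homogeneousComponent_mem_of_mem
      (P.homogeneousCore (homogeneousSubmodule σ K)).isHomogeneous hp 0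
    have h1 := Ideal.toIdeal_homogeneousCore_le _ _ h0
    simp only [homogeneousComponent_zero] at h1
    by_contra hne
    have hunit : IsUnit (C (coeff 0 p) : MvPolynomial σ K) :=
      (IsUnit.mk0 _ (fun h => hne h)).map C
    exact hP.ne_top (Ideal.eq_top_of_isUnit_mem _ h1 hunit)

lemma MvPolynomial.IsHomogeneous.aeval_smul {σ R A : Type*} [CommSemiring R] [CommSemiring A]
    [Algebra R A] {p : MvPolynomial σ R} {d : ℕ} (hp : p.IsHomogeneous d) (c : A) (x : σ → A) :
    MvPolynomial.aeval (c • x) p = c ^ d * MvPolynomial.aeval x p := by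
  rw [aeval_def, aeval_def, eval₂_eq, eval₂_eq, Finset.mul_sum]
  refine Finset.sum_congr rfl fun m hm => ?_
  have hdeg : ∑ i ∈ m.support, m i = d := by
    have := hp (mem_support_iff.1 hm)
    rw [Finsupp.weight_apply, Finsupp.sum] at this
    simpa using this
  simp only [Pi.smul_apply, smul_eq_mul, mul_pow, Finset.prod_mul_distrib,
    Finset.prod_pow_eq_pow_sum, hdeg]
  ring

lemma isHomogeneous_jacMinor {K : Type*} [Field K] {n r : ℕ}
    {f : Fin r → MvPolynomial (Fin n) K} {df : Fin r → ℕ}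
    (hf : ∀ i, (f i).IsHomogeneous (df i)) (c : Fin r → Fin n) :
    (jacMinor f c).IsHomogeneous (∑ i, (df i - 1)) := by
  rw [jacMinor, Matrix.det_apply]
  refine IsHomogeneous.sum _ _ _ fun τ _ => ?_
  refine Submodule.smul_of_tower_mem (homogeneousSubmodule (Fin n) K _) _ ?_
  rw [mem_homogeneousSubmodule, ← Equiv.sum_comp τ]
  exact IsHomogeneous.prod _ _ _ fun i _ => (hf (τ i)).pderiv

lemma isHomogeneous_span_range {K : Type*} [Field K] {n r : ℕ}
    {f : Fin r → MvPolynomial (Fin n) K} {df : Fin r → ℕ}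
    (hf : ∀ i, (f i).IsHomogeneous (df i)) :
    (Ideal.span (Set.range f)).IsHomogeneous (homogeneousSubmodule (Fin n) K) := by
  refine Ideal.homogeneous_span _ _ ?_
  rintro _ ⟨i, rfl⟩
  exact ⟨df i, hf i⟩

lemma isHomogeneous_singIdeal {K : Type*} [Field K] {n r : ℕ}
    {f : Fin r → MvPolynomial (Fin n) K} {df : Fin r → ℕ}
    (hf : ∀ i, (f i).IsHomogeneous (df i)) :
    (singIdeal f).IsHomogeneous (homogeneousSubmodule (Fin n) K) := by
  refine Ideal.homogeneous_span _ _ ?_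
  rintro _ (⟨i, rfl⟩ | ⟨c, rfl⟩)
  · exact ⟨df i, hf i⟩
  · exact ⟨_, isHomogeneous_jacMinor hf c⟩

/-- A system of forms whose singular cone has dimension at most zero is non-singular. -/
lemma projNonsingular_of_ringKrullDim_le_zero {K : Type*} [Field K] {n r : ℕ}
    {f : Fin r → MvPolynomial (Fin n) K} {df : Fin r → ℕ}
    (hf : ∀ i, (f i).IsHomogeneous (df i))
    (h : ringKrullDim (MvPolynomial (Fin n) K ⧸ singIdeal f) ≤ 0) : ProjNonsingular f := by
  intro P hP hle i
  obtain ⟨Q, hQ, hIQ, hQP, hQm⟩ :=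
    exists_isPrime_le_ker_constantCoeff (isHomogeneous_singIdeal hf) hP hle
  refine hQP ?_
  have hX : (X i : MvPolynomial (Fin n) K) ∈
      RingHom.ker (constantCoeff : MvPolynomial (Fin n) K →+* K) := constantCoeff_X K i
  rcases hQm.eq_or_lt with heq | hlt
  · rwa [heq]
  · exfalso
    rw [ringKrullDim_quotient] at h
    have h1 : 1 ≤ Order.krullDim (PrimeSpectrum.zeroLocus (R := MvPolynomial (Fin n) K)
        (singIdeal f)) :=
      Order.one_le_krullDim_iff.2 ⟨⟨⟨Q, hQ⟩, hIQ⟩,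
        ⟨⟨_, RingHom.ker_isPrime constantCoeff⟩, hIQ.trans hQm⟩, hlt⟩
    exact absurd (h1.trans h) (by decide)

/-- If a matrix has a nonzero maximal minor and all larger minors obtained by appending a row `y`
vanish, then `y` is a combination of the rows. -/
lemma exists_eq_sum_of_det_snoc_eq_zero {L : Type*} [Field L] {s n : ℕ}
    (M : Fin s → Fin n → L) (y : Fin n → L) (c : Fin s → Fin n)
    (hc : (Matrix.of fun i j => M i (c j)).det ≠ 0)
    (h : ∀ c' : Fin (s + 1) → Fin n,
      (Matrix.of fun i j => (Fin.snoc M y : Fin (s + 1) → Fin n → L) i (c' j)).det = 0) :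
    ∃ v : Fin s → L, ∀ j, y j = ∑ i, v i * M i j := by
  set A : Matrix (Fin s) (Fin s) L := Matrix.of fun i j => M i (c j) with hA
  let inv : Invertible A := Matrix.invertibleOfIsUnitDet A (IsUnit.mk0 _ hc)
  let Y : Matrix (Fin 1) (Fin s) L := Matrix.of fun _ j => y (c j)
  refine ⟨(Y * ⅟A) 0, fun j => ?_⟩
  let B : Matrix (Fin s) (Fin 1) L := Matrix.of fun i _ => M i j
  let D : Matrix (Fin 1) (Fin 1) L := Matrix.of fun _ _ => y j
  have hblock : (Matrix.fromBlocks A B Y D).det = 0 := by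
    rw [← h (Fin.snoc c j), ← Matrix.det_submatrix_equiv_self finSumFinEquiv]
    congr 1
    ext i k
    have h0 : ∀ a : Fin 1, Fin.natAdd s a = Fin.last s := fun a => by
      ext; simp
    have h1 : ∀ a : Fin s, Fin.castAdd 1 a = Fin.castSucc a := fun a => rfl
    rcases i with i | i <;> rcases k with k | k <;>
      simp [A, B, D, Y, h0, h1]
  rw [Matrix.det_fromBlocks₁₁] at hblock
  have hdet := (mul_eq_zero.1 hblock).resolve_left hc
  rw [Matrix.det_fin_one, Matrix.sub_apply, Matrix.mul_apply] at hdet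
  exact sub_eq_zero.1 hdet

/-- The linear form with coefficients `y`. -/
noncomputable def linForm {K : Type*} [Field K] {n : ℕ} (y : Fin n → K) : MvPolynomial (Fin n) K :=
  ∑ i, C (y i) * X i

lemma isHomogeneous_linForm {K : Type*} [Field K] {n : ℕ} (y : Fin n → K) :
    (linForm y).IsHomogeneous 1 :=
  IsHomogeneous.sum _ _ _ fun i _ => by
    simpa using (isHomogeneous_C _ (y i)).mul (isHomogeneous_X K i)

lemma pderiv_linForm {K : Type*} [Field K] {n : ℕ} (y : Fin n → K) (j : Fin n) :
    pderiv j (linForm y) = C (y j) := by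
  simp [linForm, map_sum, pderiv_X, Pi.single_apply]

/-- A generic linear form avoids a given ideal that does not contain all variables. -/
lemma exists_ne_zero_linForm_notMem {K : Type*} [Field K] {n : ℕ}
    {Q : Ideal (MvPolynomial (Fin n) K)} (hQ : ∃ k, (X k : MvPolynomial (Fin n) K) ∉ Q) :
    ∃ h : MvPolynomial (Fin n) K, h ≠ 0 ∧ ∀ y, eval y h ≠ 0 → linForm y ∉ Q := by
  obtain ⟨k, hk⟩ := hQ
  obtain ⟨ψ, hψ⟩ := Module.Projective.exists_dual_ne_zero K
    (x := Ideal.Quotient.mk Q (X k)) (fun h0 => hk (Ideal.Quotient.eq_zero_iff_mem.1 h0))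
  refine ⟨∑ i, C (ψ (Ideal.Quotient.mk Q (X i))) * X i, fun h0 => hψ ?_, fun y hy hmem => hy ?_⟩
  · have := congrArg (eval (Pi.single k 1)) h0
    simpa [map_sum, Pi.single_apply] using this
  · have h1 : Ideal.Quotient.mkₐ K Q (linForm y) = 0 := Ideal.Quotient.eq_zero_iff_mem.2 hmem
    have h2 := congrArg ψ h1
    rw [map_zero, linForm, map_sum, map_sum] at h2
    rw [← h2, map_sum]
    refine Finset.sum_congr rfl fun i _ => ?_
    rw [← smul_eq_C_mul (X i) (y i), map_smul (Ideal.Quotient.mkₐ K Q), map_smul ψ]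
    simp [mul_comm]

/-- The conormal directions along the cone over a projective complete intersection, away from a
coordinate hyperplane, lie in a hypersurface. -/
lemma exists_ne_zero_conormal {K : Type u} [Field K] {n s e : ℕ}
    {F : Fin s → MvPolynomial (Fin n) K} {dF : Fin s → ℕ}
    (hF : ∀ i, (F i).IsHomogeneous (dF i)) (hes : e + s < n)
    (hdim : ringKrullDim (MvPolynomial (Fin n) K ⧸ Ideal.span (Set.range F))
      ≤ ((e + 1 : ℕ) : WithBot ℕ∞)) (k : Fin n) :
    ∃ g : MvPolynomial (Fin n) K, g ≠ 0 ∧ ∀ y, eval y g ≠ 0 →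
      ∀ (L : Type u) [Field L] [Algebra K L] (x : Fin n → L) (v : Fin s → L), x k ≠ 0 →
        (∀ i, aeval x (F i) = 0) →
        ¬ ∀ j, algebraMap K L (y j) = ∑ i, v i * aeval x (pderiv j (F i)) := by
  set J : Ideal (MvPolynomial (Fin n) K) := Ideal.span (Set.range F ∪ {X k - 1}) with hJ
  have hJdim : ringKrullDim (MvPolynomial (Fin n) K ⧸ J) ≤ (e : WithBot ℕ∞) := by
    refine ringKrullDim_quotient_le_of_forall_isPrime hdim fun P hP hJP => Or.inr ?_
    have hFP : Ideal.span (Set.range F) ≤ P :=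
      (Ideal.span_mono Set.subset_union_left).trans hJP
    obtain ⟨Q, hQ, hIQ, hQP, hQm⟩ :=
      exists_isPrime_le_ker_constantCoeff (isHomogeneous_span_range hF) hP hFP
    refine ⟨Q, hQ, hIQ, lt_of_le_of_ne hQP fun heq => ?_⟩
    have hmem : (X k - 1 : MvPolynomial (Fin n) K) ∈ Q := by
      rw [heq]
      exact hJP (Ideal.subset_span (Or.inr rfl))
    have : constantCoeff (X k - 1 : MvPolynomial (Fin n) K) = 0 := hQm hmem
    simp at this
  have hA : ringKrullDim (MvPolynomial (Fin s) (MvPolynomial (Fin n) K ⧸ J))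
      < (n : WithBot ℕ∞) := by
    rw [MvPolynomial.ringKrullDim_of_isNoetherianRing]
    refine lt_of_le_of_lt (b := ((e + s : ℕ) : WithBot ℕ∞)) ?_ (by exact_mod_cast hes)
    rw [Nat.cast_add, Nat.card_eq_fintype_card, Fintype.card_fin]
    gcongr
  let φ : MvPolynomial (Fin n) K →ₐ[K] MvPolynomial (Fin s) (MvPolynomial (Fin n) K ⧸ J) :=
    aeval fun j => ∑ i, X i * C (Ideal.Quotient.mk J (pderiv j (F i)))
  have hft : Algebra.FiniteType K (MvPolynomial (Fin s) (MvPolynomial (Fin n) K ⧸ J)) :=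
    Algebra.FiniteType.trans (S := MvPolynomial (Fin n) K ⧸ J) inferInstance inferInstance
  have hφ := not_injective_of_ringKrullDim_lt (K := K)
    (A := MvPolynomial (Fin s) (MvPolynomial (Fin n) K ⧸ J)) hA φ
  rw [injective_iff_map_eq_zero] at hφ
  push Not at hφ
  obtain ⟨g, hg0, hg⟩ := hφ
  refine ⟨g, hg, fun y hy L _ _ x v hxk hx hyx => hy ?_⟩
  -- rescale the point so that its `k`-th coordinate is one
  set x' : Fin n → L := (x k)⁻¹ • x with hx'
  have hpt : ∀ a ∈ J, (aeval x' : MvPolynomial (Fin n) K →ₐ[K] L) a = 0 := by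
    have : J ≤ RingHom.ker (aeval x' : MvPolynomial (Fin n) K →ₐ[K] L) := by
      rw [hJ, Ideal.span_le]
      rintro _ (⟨i, rfl⟩ | rfl)
      · change aeval x' (F i) = 0
        rw [hx', (hF i).aeval_smul, hx i, mul_zero]
      · change aeval x' (X k - 1) = 0
        simp [hx', hxk]
    exact this
  let π : MvPolynomial (Fin n) K ⧸ J →ₐ[K] L := Ideal.Quotient.liftₐ J (aeval x') hpt
  let θ : MvPolynomial (Fin s) (MvPolynomial (Fin n) K ⧸ J) →+* L :=
    eval₂Hom π.toRingHom fun i => x k ^ (dF i - 1) * v i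
  have hcomp : θ.comp φ.toRingHom = (algebraMap K L).comp (eval y) := by
    refine MvPolynomial.ringHom_ext (fun a => ?_) fun j => ?_
    · simp [θ, φ, algebraMap_eq, IsScalarTower.algebraMap_apply K (MvPolynomial (Fin n) K ⧸ J)
        (MvPolynomial (Fin s) (MvPolynomial (Fin n) K ⧸ J))]
    · simp only [RingHom.comp_apply, eval_X, hyx j]
      change θ (φ (X j)) = _
      simp only [φ, aeval_X, map_sum, map_mul]
      refine Finset.sum_congr rfl fun i _ => ?_
      have h1 : θ (C (Ideal.Quotient.mk J (pderiv j (F i)))) = aeval x' (pderiv j (F i)) := by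
        rw [coe_eval₂Hom, eval₂_C]
        rfl
      rw [h1, hx', (hF i).pderiv.aeval_smul, coe_eval₂Hom, eval₂_X, inv_pow]
      field_simp
  have := congrArg (fun r => r g) hcomp
  simp only [RingHom.comp_apply] at this
  rw [show φ.toRingHom g = 0 from hg0, map_zero] at this
  exact (map_eq_zero (algebraMap K L)).1 this.symm

lemma isMaximal_or_exists_isPrime_lt {K : Type*} [Field K] {n : ℕ}
    {I P : Ideal (MvPolynomial (Fin n) K)} {p : MvPolynomial (Fin n) K}
    (hI : ∀ Q ∈ I.minimalPrimes, (∃ k, (X k : MvPolynomial (Fin n) K) ∉ Q) → p ∉ Q)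
    (hP : P.IsPrime) (hIP : I ≤ P) (hp : p ∈ P) :
    P.IsMaximal ∨ ∃ Q : Ideal (MvPolynomial (Fin n) K), Q.IsPrime ∧ I ≤ Q ∧ Q < P := by
  obtain ⟨Q, hQ, hQP⟩ := Ideal.exists_minimalPrimes_le hIP
  by_cases hX : ∃ k, (X k : MvPolynomial (Fin n) K) ∉ Q
  · exact Or.inr ⟨Q, hQ.1.1, hQ.1.2, lt_of_le_of_ne hQP fun heq => hI Q hQ hX (heq ▸ hp)⟩
  · push Not at hX
    exact Or.inl (isMaximal_of_X_mem hP fun i => hQP (hX i))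

/-- At a singular prime of the section by a hyperplane that is nowhere conormal, the original
system is already singular. -/
lemma singIdeal_le_of_singIdeal_snoc_le {K : Type u} [Field K] {n s : ℕ}
    {F : Fin s → MvPolynomial (Fin n) K} {y : Fin n → K} {k : Fin n}
    (hy : ∀ (L : Type u) [Field L] [Algebra K L] (x : Fin n → L) (v : Fin s → L), x k ≠ 0 →
      (∀ i, aeval x (F i) = 0) →
      ¬ ∀ j, algebraMap K L (y j) = ∑ i, v i * aeval x (pderiv j (F i)))
    {P : Ideal (MvPolynomial (Fin n) K)} (hP : P.IsPrime)
    (hk : (X k : MvPolynomial (Fin n) K) ∉ P)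
    (hle : singIdeal (Fin.snoc F (linForm y) : Fin (s + 1) → MvPolynomial (Fin n) K) ≤ P) :
    singIdeal F ≤ P := by
  have hFP : ∀ i, F i ∈ P := fun i => hle (Ideal.subset_span (Or.inl ⟨i.castSucc, by simp⟩))
  rw [singIdeal, Ideal.span_le]
  rintro _ (⟨i, rfl⟩ | ⟨c, rfl⟩)
  · exact hFP i
  by_contra hc
  let L := FractionRing (MvPolynomial (Fin n) K ⧸ P)
  let ev : MvPolynomial (Fin n) K →ₐ[K] L :=
    (IsScalarTower.toAlgHom K (MvPolynomial (Fin n) K ⧸ P) L).comp (Ideal.Quotient.mkₐ K P)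
  have hev : ∀ p, ev p = 0 ↔ p ∈ P := fun p => by
    change algebraMap (MvPolynomial (Fin n) K ⧸ P) L (Ideal.Quotient.mk P p) = 0 ↔ _
    rw [map_eq_zero_iff _ (IsFractionRing.injective (MvPolynomial (Fin n) K ⧸ P) L),
      Ideal.Quotient.eq_zero_iff_mem]
  have haev : aeval (fun j => ev (X j)) = ev := (MvPolynomial.aeval_unique ev).symm
  obtain ⟨v, hv⟩ := exists_eq_sum_of_det_snoc_eq_zero
    (fun i j => ev (pderiv j (F i))) (fun j => algebraMap K L (y j)) c
    (by
      intro h0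
      refine hc ((hev _).1 ?_)
      rw [jacMinor, AlgHom.map_det]
      exact h0)
    (by
      intro c'
      have h0 : ev (jacMinor (Fin.snoc F (linForm y) : Fin (s + 1) → _) c') = 0 :=
        (hev _).2 (hle (Ideal.subset_span (Or.inr ⟨c', rfl⟩)))
      rw [jacMinor, AlgHom.map_det] at h0
      rw [← h0]
      congr 1
      ext i j
      refine Fin.lastCases ?_ (fun i => ?_) i
      · have hC : ev (C (y (c' j))) = algebraMap K L (y (c' j)) := ev.commutes _
        simp [pderiv_linForm, hC]
      · simp)
  refine hy L (fun j => ev (X j)) v (fun h0 => hk ((hev _).1 h0)) (fun i => ?_) fun j => ?_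
  · rw [haev]
    exact (hev _).2 (hFP i)
  · rw [haev]
    exact hv j

/-- A generic hyperplane section of a complete intersection cuts down its dimension and that of
its singular locus. -/
lemma exists_linForm_ringKrullDim_le {K : Type u} [Field K] [Infinite K] {n s e w : ℕ}
    {F : Fin s → MvPolynomial (Fin n) K} {dF : Fin s → ℕ}
    (hF : ∀ i, (F i).IsHomogeneous (dF i)) (hes : e + s < n)
    (hdim : ringKrullDim (MvPolynomial (Fin n) K ⧸ Ideal.span (Set.range F))
      ≤ ((e + 1 : ℕ) : WithBot ℕ∞))
    (hsing : ringKrullDim (MvPolynomial (Fin n) K ⧸ singIdeal F) ≤ ((w + 1 : ℕ) : WithBot ℕ∞)) :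
    ∃ y : Fin n → K,
      ringKrullDim (MvPolynomial (Fin n) K ⧸ Ideal.span (Set.range
        (Fin.snoc F (linForm y) : Fin (s + 1) → MvPolynomial (Fin n) K))) ≤ (e : WithBot ℕ∞) ∧
      ringKrullDim (MvPolynomial (Fin n) K ⧸
        singIdeal (Fin.snoc F (linForm y) : Fin (s + 1) → MvPolynomial (Fin n) K))
        ≤ (w : WithBot ℕ∞) := by
  have havoid : ∀ Q : Ideal (MvPolynomial (Fin n) K), ∃ h : MvPolynomial (Fin n) K, h ≠ 0 ∧
      ∀ y, eval y h ≠ 0 → (∃ k, (X k : MvPolynomial (Fin n) K) ∉ Q) → linForm y ∉ Q := by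
    intro Q
    by_cases hQ : ∃ k, (X k : MvPolynomial (Fin n) K) ∉ Q
    · obtain ⟨h, h0, hh⟩ := exists_ne_zero_linForm_notMem hQ
      exact ⟨h, h0, fun y hy _ => hh y hy⟩
    · exact ⟨1, one_ne_zero, fun _ _ hQ' => absurd hQ' hQ⟩
  choose h h0 hh using havoid
  choose g g0 hg using exists_ne_zero_conormal hF hes hdim
  have hfin : ((Ideal.span (Set.range F)).minimalPrimes ∪ (singIdeal F).minimalPrimes).Finite :=
    (Ideal.finite_minimalPrimes_of_isNoetherianRing _ _).union
      (Ideal.finite_minimalPrimes_of_isNoetherianRing _ _)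
  have hprod : (∏ Q ∈ hfin.toFinset, h Q) * ∏ k, g k ≠ 0 :=
    mul_ne_zero (Finset.prod_ne_zero_iff.2 fun Q _ => h0 Q)
      (Finset.prod_ne_zero_iff.2 fun k _ => g0 k)
  obtain ⟨y, hy⟩ : ∃ y, eval y ((∏ Q ∈ hfin.toFinset, h Q) * ∏ k, g k) ≠ 0 := by
    by_contra hne
    push Not at hne
    exact hprod (MvPolynomial.funext fun y => by rw [hne y, map_zero])
  rw [map_mul, map_prod, map_prod, mul_ne_zero_iff, Finset.prod_ne_zero_iff,
    Finset.prod_ne_zero_iff] at hy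
  have hmin : ∀ Q ∈ (Ideal.span (Set.range F)).minimalPrimes ∪ (singIdeal F).minimalPrimes,
      (∃ k, (X k : MvPolynomial (Fin n) K) ∉ Q) → linForm y ∉ Q := fun Q hQ =>
    hh Q y (hy.1 Q (hfin.mem_toFinset.2 hQ))
  refine ⟨y, ringKrullDim_quotient_le_of_forall_isPrime hdim fun P hP hle => ?_,
    ringKrullDim_quotient_le_of_forall_isPrime hsing fun P hP hle => ?_⟩
  · refine isMaximal_or_exists_isPrime_lt (fun Q hQ => hmin Q (Or.inl hQ)) hP ?_
      (hle (Ideal.subset_span ⟨Fin.last s, by simp⟩))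
    rw [Ideal.span_le]
    rintro _ ⟨i, rfl⟩
    exact hle (Ideal.subset_span ⟨i.castSucc, by simp⟩)
  · by_cases hX : ∃ k, (X k : MvPolynomial (Fin n) K) ∉ P
    · obtain ⟨k, hk⟩ := hX
      exact isMaximal_or_exists_isPrime_lt (fun Q hQ => hmin Q (Or.inr hQ)) hP
        (singIdeal_le_of_singIdeal_snoc_le (hg k y (hy.2 k (Finset.mem_univ k))) hP hk hle)
        (hle (Ideal.subset_span (Or.inl ⟨Fin.last s, by simp⟩)))
    · push Not at hX
      exact Or.inl (isMaximal_of_X_mem hP hX)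

lemma range_append_eq_union {R : Type*} {r t : ℕ} (f : Fin r → R) (l : Fin t → R) :
    Set.range (Fin.append f l) = Set.range f ∪ Set.range l := by
  ext p
  constructor
  · rintro ⟨i, rfl⟩
    refine Fin.addCases (fun i => ?_) (fun i => ?_) i
    · exact Or.inl ⟨i, by simp⟩
    · exact Or.inr ⟨i, by simp⟩
  · rintro (⟨i, rfl⟩ | ⟨i, rfl⟩)
    · exact ⟨Fin.castAdd t i, by simp⟩
    · exact ⟨Fin.natAdd r i, by simp⟩

lemma isHomogeneous_append {K : Type*} [Field K] {n r t : ℕ}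
    {f : Fin r → MvPolynomial (Fin n) K} {df : Fin r → ℕ} (hf : ∀ i, (f i).IsHomogeneous (df i))
    {l : Fin t → MvPolynomial (Fin n) K} (hl : ∀ i, (l i).IsHomogeneous 1) (i : Fin (r + t)) :
    (Fin.append f l i).IsHomogeneous (Fin.append df (fun _ => 1) i) := by
  refine Fin.addCases (fun i => ?_) (fun i => ?_) i
  · simpa using hf i
  · simpa using hl i

lemma constantCoeff_eq_zero_of_isHomogeneous {σ R : Type*} [CommSemiring R]
    {p : MvPolynomial σ R} {d : ℕ} (hp : p.IsHomogeneous d) (hd : 1 ≤ d) :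
    constantCoeff p = 0 := by
  rw [constantCoeff_eq]
  exact hp.coeff_eq_zero (by simp; omega)

/-- Iterated generic hyperplane sections of a complete intersection. -/
lemma exists_linForms_ringKrullDim_le {K : Type u} [Field K] [Infinite K] {n r t : ℕ}
    {f : Fin r → MvPolynomial (Fin n) K} {df : Fin r → ℕ}
    (hf : ∀ i, (f i).IsHomogeneous (df i)) (hdf : ∀ i, 1 ≤ df i) (htr : t + r ≤ n)
    (hdim : ringKrullDim (MvPolynomial (Fin n) K ⧸ Ideal.span (Set.range f))
      ≤ ((n - r : ℕ) : WithBot ℕ∞))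
    (hsing : ringKrullDim (MvPolynomial (Fin n) K ⧸ singIdeal f) ≤ (t : WithBot ℕ∞))
    (j : ℕ) (hj : j ≤ t) :
    ∃ l : Fin j → MvPolynomial (Fin n) K,
      (∀ i, (l i).IsHomogeneous 1) ∧ LinearIndependent K l ∧
      ringKrullDim (MvPolynomial (Fin n) K ⧸ Ideal.span (Set.range (Fin.append f l)))
        ≤ ((n - r - j : ℕ) : WithBot ℕ∞) ∧
      ringKrullDim (MvPolynomial (Fin n) K ⧸ singIdeal (Fin.append f l))
        ≤ ((t - j : ℕ) : WithBot ℕ∞) := by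
  induction j with
  | zero =>
    refine ⟨Fin.elim0, fun i => i.elim0, linearIndependent_empty_type, ?_, ?_⟩
    · rw [Fin.append_elim0]
      exact hdim
    · rw [Fin.append_elim0]
      exact hsing
  | succ j ih =>
    obtain ⟨l, hl, hli, hld, hls⟩ := ih (by omega)
    have hhom := isHomogeneous_append hf hl
    obtain ⟨y, hyd, hys⟩ := exists_linForm_ringKrullDim_le (e := n - r - (j + 1))
      (w := t - (j + 1)) hhom (by omega)
      (by rwa [show n - r - (j + 1) + 1 = n - r - j by omega])
      (by rwa [show t - (j + 1) + 1 = t - j by omega])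
    refine ⟨Fin.snoc l (linForm y), fun i => ?_, ?_, ?_, ?_⟩
    · refine Fin.lastCases ?_ (fun i => ?_) i
      · simpa using isHomogeneous_linForm y
      · simpa using hl i
    · refine linearIndependent_finSnoc.2 ⟨hli, fun hmem => ?_⟩
      have hmem' : linForm y ∈ Ideal.span (Set.range (Fin.append f l)) := by
        have hsub : Submodule.span K (Set.range l) ≤
            (Ideal.span (Set.range (Fin.append f l))).restrictScalars K := by
          rw [Submodule.span_le]
          rintro _ ⟨i, rfl⟩
          exact Ideal.subset_span ⟨Fin.natAdd r i, by simp⟩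
        exact hsub hmem
      have heq : Ideal.span (Set.range
          (Fin.snoc (Fin.append f l) (linForm y) : Fin (r + j + 1) → _))
          = Ideal.span (Set.range (Fin.append f l)) := by
        refine le_antisymm ?_ (Ideal.span_mono ?_)
        · rw [Ideal.span_le]
          rintro _ ⟨i, rfl⟩
          refine Fin.lastCases ?_ (fun i => ?_) i
          · simpa using hmem'
          · simpa using Ideal.subset_span (Set.mem_range_self i)
        · rintro _ ⟨i, rfl⟩
          exact ⟨i.castSucc, by simp⟩
      rw [heq] at hyd
      have hlow := le_ringKrullDim_quotient_span_range_add (F := Fin.append f l) fun i =>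
        constantCoeff_eq_zero_of_isHomogeneous (hhom i) (by
          refine Fin.addCases (fun i => ?_) (fun i => ?_) i
          · simpa using hdf i
          · simp)
      have hlow' : (n : WithBot ℕ∞) ≤ ((n - r - (j + 1) + (r + j) : ℕ) : WithBot ℕ∞) := by
        refine hlow.trans ?_
        rw [Nat.cast_add (n - r - (j + 1))]
        gcongr
      have : n ≤ n - r - (j + 1) + (r + j) := by exact_mod_cast hlow'
      omega
    · rw [Fin.append_snoc]
      exact hyd
    · rw [Fin.append_snoc]
      exact hys

/-- **Bertini over an infinite field.** Let `X ⊂ P^{n-1}_K` be a complete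
intersection cut out by forms `f i` of degrees `df i`, of degree `d = ∏ df i` and
dimension `m = n - 1 - r` (cone dimension `n - r`), with `dim Sing X = σ`; writing
`t = σ + 1`, the cone over `Sing X` has dimension `≤ t`. Then there is a linear subspace
`L ⊆ P^{n-1}_K` of codimension `σ + 1 = t`, cut out by `t` linearly independent linear
forms, such that `X ∩ L` is non-singular of dimension `m - σ - 1` (cone dimension
`n - r - t`); `X ∩ L` is again the complete intersection of the same forms `f i` with
`L`, hence of the same degree `d = ∏ df i`. -/
theorem statement5 {K : Type*} [Field K] [Infinite K] {n r t d : ℕ}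
    (f : Fin r → MvPolynomial (Fin n) K) (df : Fin r → ℕ)
    (hf : ∀ i, (f i).IsHomogeneous (df i)) (hdf : ∀ i, 1 ≤ df i)
    (hd : d = ∏ i, df i) (hr : r ≤ n) (ht : t ≤ n - r)
    (hCI : ringKrullDim (MvPolynomial (Fin n) K ⧸ Ideal.span (Set.range f))
      = ((n - r : ℕ) : WithBot ℕ∞))
    (hσ : ringKrullDim (MvPolynomial (Fin n) K ⧸ singIdeal f) ≤ (t : WithBot ℕ∞)) :
    ∃ ℓ : Fin t → MvPolynomial (Fin n) K,
      (∀ j, (ℓ j).IsHomogeneous 1) ∧ LinearIndependent K ℓ ∧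
      ringKrullDim (MvPolynomial (Fin n) K ⧸ Ideal.span (Set.range f ∪ Set.range ℓ))
        = ((n - r - t : ℕ) : WithBot ℕ∞) ∧
      ProjNonsingular (Fin.append f ℓ) := by
  obtain ⟨l, hl, hli, hld, hls⟩ := exists_linForms_ringKrullDim_le hf hdf (by omega) hCI.le hσ
    t le_rfl
  have hhom := isHomogeneous_append hf hl
  refine ⟨l, hl, hli, ?_, projNonsingular_of_ringKrullDim_le_zero hhom (by simpa using hls)⟩
  have hlow := le_ringKrullDim_quotient_span_range_add (F := Fin.append f l) fun i =>
    constantCoeff_eq_zero_of_isHomogeneous (hhom i) (by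
      refine Fin.addCases (fun i => ?_) (fun i => ?_) i
      · simpa using hdf i
      · simp)
  rw [range_append_eq_union] at hld hlow
  refine le_antisymm hld ?_
  generalize ringKrullDim (MvPolynomial (Fin n) K ⧸ Ideal.span (Set.range f ∪ Set.range l)) = D
    at hld hlow
  induction D using WithBot.recBotCoe with
  | bot => simp at hlow
  | coe D =>
    have hD : D ≠ ⊤ := fun h => by
      rw [h] at hld
      exact absurd (WithBot.coe_le_coe.1 hld) (by simp)
    lift D to ℕ using hD
    have : n ≤ D + (r + t) := by exact_mod_cast hlow
    have h2 : n - r - t ≤ D := by omega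
    exact WithBot.coe_le_coe.2 (Nat.cast_le.2 h2)
end

section
/- Let K be a field of characteristic zero and F, G ∈ K[x_1,…,x_n] homogeneous polynomials with deg G ≥ 2, n ≥ 3. Suppose Y = V(F,G) is a non-singular complete intersection of dimension n−3 and V(G) is non-singular. For −1 ≤ s ≤ n−3, let T_s(F,G) be the closed set of z ∈ P^{n-1}_K with dim Sing(Diff_z(F,G)) ≥ s, where Diff_z(F,G) = V(F,G,G^z). Then dim T_s(F,G) ≤ n−2−s. -/
open MvPolynomial

theorem exists_algebraicIndependent_comp_of_adjoin_eq_top {K A : Type*} [Field K] [CommRing A]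
    [IsDomain A] [Algebra K A] {m s : ℕ} {ι : Type*} {v : ι → A}
    (hv : Algebra.adjoin K (Set.range v) = ⊤) {y : Fin s → A} (hy : AlgebraicIndependent K y)
    (hms : m ≤ s) : ∃ S : Fin m → ι, AlgebraicIndependent K (v ∘ S) := by
  have : Algebra.IsAlgebraic (Algebra.adjoin K (Set.range v)) A := by
    refine ⟨fun a => ?_⟩
    have ha : a ∈ Algebra.adjoin K (Set.range v) := by simp [hv]
    exact isAlgebraic_algebraMap (⟨a, ha⟩ : Algebra.adjoin K (Set.range v))
  obtain ⟨T, hT, hTb⟩ := exists_isTranscendenceBasis_subset (R := K) (Set.range v)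
  have hcard : (s : Cardinal) ≤ Cardinal.mk T := by
    have := hy.lift_cardinalMk_le_trdeg
    rw [← hTb.cardinalMk_eq_trdeg] at this
    simpa using this
  have hmT : Cardinal.lift (Cardinal.mk (Fin m)) ≤ Cardinal.lift (Cardinal.mk T) := by
    simpa using (Nat.cast_le.mpr hms).trans hcard
  obtain ⟨e⟩ := Cardinal.lift_mk_le'.mp hmT
  choose S hS using fun i => hT (e i).2
  refine ⟨S, ?_⟩
  convert! hTb.1.comp e e.injective
  exact funext hS

theorem exists_rename_mem_imp_eq_zero_of_le_ringKrullDim {K : Type*} [Field K] {n m : ℕ}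
    (I : Ideal (MvPolynomial (Fin n) K))
    (h : (m : WithBot ℕ∞) ≤ ringKrullDim (MvPolynomial (Fin n) K ⧸ I)) :
    ∃ S : Fin m → Fin n, ∀ p : MvPolynomial (Fin m) K, rename S p ∈ I → p = 0 := by
  have hnt : Nontrivial (MvPolynomial (Fin n) K ⧸ I) := by
    by_contra hc
    rw [not_nontrivial_iff_subsingleton] at hc
    rw [ringKrullDim_eq_bot_of_subsingleton] at h
    simp at h
  obtain ⟨s, g, hg, hint⟩ := exists_integral_inj_algHom_of_fg K (MvPolynomial (Fin n) K ⧸ I)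
  have hms : m ≤ s := by
    have hle : ringKrullDim (MvPolynomial (Fin n) K ⧸ I) ≤
        ringKrullDim (MvPolynomial (Fin s) K) := by
      let := g.toRingHom.toAlgebra
      have : Algebra.IsIntegral (MvPolynomial (Fin s) K) (MvPolynomial (Fin n) K ⧸ I) := ⟨hint⟩
      refine Order.krullDim_le_of_strictMono (PrimeSpectrum.comap g.toRingHom) ?_
      intro P Q hPQ
      exact Ideal.IsIntegral.comap_lt_comap (R := MvPolynomial (Fin s) K) hPQ
    rw [MvPolynomial.ringKrullDim_of_isNoetherianRing, ringKrullDim_eq_zero_of_field] at hle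
    simpa using h.trans hle
  obtain ⟨Q, hQ, -, hdisj⟩ := Ideal.exists_le_prime_disjoint
    (⊥ : Ideal (MvPolynomial (Fin n) K ⧸ I))
    ((nonZeroDivisors (MvPolynomial (Fin s) K)).map g.toRingHom) (by
      rw [Set.disjoint_left]
      rintro _ h0 ⟨p, hp, rfl⟩
      exact nonZeroDivisors.ne_zero hp ((map_eq_zero_iff g hg).mp h0))
  let π := Ideal.Quotient.mkₐ K Q
  let φ : MvPolynomial (Fin n) K →ₐ[K] (MvPolynomial (Fin n) K ⧸ I) ⧸ Q :=
    π.comp (Ideal.Quotient.mkₐ K I)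
  have hφ : Function.Surjective φ :=
    (Ideal.Quotient.mk_surjective).comp Ideal.Quotient.mk_surjective
  have hyind : AlgebraicIndependent K (fun i => π (g (X i))) := by
    have h2 : (aeval fun i => π (g (X i))) = π.comp g := by ext; simp
    rw [AlgebraicIndependent, h2, injective_iff_map_eq_zero]
    intro p hp
    by_contra hne
    have h3 : g p ∈ Q := Ideal.Quotient.eq_zero_iff_mem.mp hp
    exact Set.disjoint_left.mp hdisj h3 ⟨p, mem_nonZeroDivisors_of_ne_zero hne, rfl⟩
  have hadj : Algebra.adjoin K (Set.range (φ ∘ X)) = ⊤ := by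
    rw [Set.range_comp, ← AlgHom.map_adjoin, MvPolynomial.adjoin_range_X, Algebra.map_top,
      AlgHom.range_eq_top]
    exact hφ
  obtain ⟨S, hS⟩ := exists_algebraicIndependent_comp_of_adjoin_eq_top hadj hyind hms
  refine ⟨S, fun p hp => hS.eq_zero_of_aeval_eq_zero p ?_⟩
  have h4 : aeval ((φ ∘ X) ∘ S) p = φ (rename S p) := by
    rw [← AlgHom.comp_apply]
    congr 1
    ext i
    simp
  rw [h4]
  simp only [φ, AlgHom.comp_apply, Ideal.Quotient.mkₐ_eq_mk, Ideal.Quotient.eq_zero_iff_mem.mpr hp,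
    map_zero]

theorem exists_derivation_of_formallyEtale {R A B : Type*} [CommRing R] [CommRing A] [CommRing B]
    [Algebra R A] [Algebra R B] [Algebra A B] [IsScalarTower R A B] [Algebra.FormallyEtale A B]
    (d : Derivation R A B) : ∃ D : Derivation R B B, ∀ a, D (algebraMap A B a) = d a := by
  let f : Ω[B⁄R] →ₗ[B] B := (d.liftKaehlerDifferential.liftBaseChange B) ∘ₗ
    (KaehlerDifferential.tensorKaehlerEquivOfFormallyEtale R A B).symm.toLinearMap
  refine ⟨f.compDer (KaehlerDifferential.D R B), fun a => ?_⟩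
  simp [f, KaehlerDifferential.tensorKaehlerEquivOfFormallyEtale_symm_D_algebraMap]

theorem exists_derivation_of_isTranscendenceBasis {K L ι : Type*} [Field K] [CharZero K] [Field L]
    [Algebra K L] [DecidableEq ι] {y : ι → L} (hy : IsTranscendenceBasis K y) (i : ι) :
    ∃ D : Derivation K L L, ∀ j, D (y j) = if j = i then 1 else 0 := by
  let : Algebra (MvPolynomial ι K) L := (aeval y : MvPolynomial ι K →ₐ[K] L).toRingHom.toAlgebra
  have halg : ∀ p : MvPolynomial ι K, algebraMap (MvPolynomial ι K) L p = aeval y p := fun _ => rfl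
  have : IsScalarTower K (MvPolynomial ι K) L := IsScalarTower.of_algebraMap_eq fun r => by
    rw [halg, MvPolynomial.algebraMap_eq, aeval_C]
  have : FaithfulSMul (MvPolynomial ι K) L :=
    (faithfulSMul_iff_algebraMap_injective _ _).mpr hy.1
  let : Algebra (FractionRing (MvPolynomial ι K)) L := FractionRing.liftAlgebra _ L
  have hPalg : Algebra.IsAlgebraic (MvPolynomial ι K) L := by
    have := hy.isAlgebraic
    refine Algebra.IsAlgebraic.of_ringHom_of_comp_eq (R := MvPolynomial ι K)
      (S := Algebra.adjoin K (Set.range y)) (A := L) (B := L) hy.1.aevalEquiv (RingHom.id L)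
      hy.1.aevalEquiv.surjective Function.injective_id ?_
    ext <;> simp [halg]
  have : Algebra.IsAlgebraic (FractionRing (MvPolynomial ι K)) L :=
    (IsFractionRing.comap_isAlgebraic_iff (A := MvPolynomial ι K)).mp hPalg
  have : CharZero (FractionRing (MvPolynomial ι K)) := charZero_of_injective_algebraMap
    (IsFractionRing.injective (MvPolynomial ι K) (FractionRing (MvPolynomial ι K)))
  have : Algebra.FormallyEtale (FractionRing (MvPolynomial ι K)) L :=
    Algebra.FormallyEtale.of_isSeparable _ _
  have : Algebra.FormallyEtale (MvPolynomial ι K) (FractionRing (MvPolynomial ι K)) :=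
    Algebra.FormallyEtale.of_isLocalization (nonZeroDivisors (MvPolynomial ι K))
  have : Algebra.FormallyEtale (MvPolynomial ι K) L :=
    Algebra.FormallyEtale.comp _ (FractionRing (MvPolynomial ι K)) _
  obtain ⟨D, hD⟩ := exists_derivation_of_formallyEtale
    (mkDerivation K (fun j => if j = i then 1 else 0) : Derivation K (MvPolynomial ι K) L)
  refine ⟨D, fun j => ?_⟩
  have := hD (X j)
  rwa [halg, aeval_X, mkDerivation_X] at this

theorem derivation_aeval {K L ι : Type*} [Fintype ι] [CommRing K] [CommRing L] [Algebra K L]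
    (D : Derivation K L L) (x : ι → L) (p : MvPolynomial ι K) :
    D (aeval x p) = ∑ i, aeval x (pderiv i p) * D (x i) := by
  classical
  induction p using MvPolynomial.induction_on with
  | C a => simp
  | add p q hp hq => simp [hp, hq, add_mul, Finset.sum_add_distrib]
  | mul_X p i hp =>
    simp only [map_mul, aeval_X, Derivation.leibniz, hp, smul_eq_mul, pderiv_X, map_add, add_mul,
      Finset.sum_add_distrib, Pi.single_apply]
    simp [Finset.mul_sum, apply_ite, mul_assoc]

theorem isAlgebraic_of_intermediateField_adjoin_eq_top {K M R : Type*} [Field K] [Field M]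
    [CommRing R] [IsDomain R] [Algebra K M] [Algebra K R] [Algebra R M] [IsScalarTower K R M]
    {s : Set M} (hs : IntermediateField.adjoin K s = ⊤) (halg : ∀ a ∈ s, IsAlgebraic R a) :
    Algebra.IsAlgebraic R M := by
  refine ⟨fun a => ?_⟩
  have ha : a ∈ IntermediateField.adjoin K s := hs ▸ IntermediateField.mem_top
  induction ha using IntermediateField.adjoin_induction with
  | mem a ha => exact halg a ha
  | algebraMap r =>
    rw [IsScalarTower.algebraMap_apply K R M]
    exact isAlgebraic_algebraMap _
  | add a b _ _ ha hb => exact ha.add hb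
  | inv a _ ha => exact ha.inv
  | mul a b _ _ ha hb => exact ha.mul hb

theorem trdeg_le_of_forall_derivation {K L M : Type*} [Field K] [CharZero K] [Field L] [Field M]
    [Algebra K L] [Algebra K M] [Algebra L M] [IsScalarTower K L M] {n : ℕ} (y : Fin n → L)
    (z : Fin n → M) [Algebra.IsAlgebraic (Algebra.adjoin K (Set.range y)) L]
    (hgen : IntermediateField.adjoin K (Set.range (algebraMap L M) ∪ Set.range z) = ⊤)
    (htan : ∀ D : Derivation K L L, ∑ i, z i * algebraMap L M (D (y i)) = 0) :
    Algebra.trdeg K M ≤ n := by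
  classical
  obtain ⟨T, hT, hTb⟩ := exists_isTranscendenceBasis_subset (R := K) (Set.range y)
  choose a ha using fun τ : T => hT τ.2
  let W : Set M := Set.range fun i => if i ∈ Set.range a then algebraMap L M (y i) else z i
  have hWT : ∀ τ : T, algebraMap L M τ ∈ W := fun τ => ⟨a τ, by simp [ha]⟩
  have hWz : ∀ i ∉ Set.range a, z i ∈ W := fun i hi => ⟨i, if_neg hi⟩
  let A := Algebra.adjoin K W
  have hmem : ∀ w ∈ W, IsAlgebraic A w := fun w hw =>
    isAlgebraic_algebraMap (⟨w, Algebra.subset_adjoin hw⟩ : A)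
  have hL : ∀ l : L, IsAlgebraic A (algebraMap L M l) := by
    have hTalg := hTb.isAlgebraic
    rw [Subtype.range_coe] at hTalg
    intro l
    let f : Algebra.adjoin K T →ₐ[K] A :=
      ((IsScalarTower.toAlgHom K L M).comp (Algebra.adjoin K T).val).codRestrict A (by
        rintro ⟨l, hl⟩
        have : (algebraMap L M l) ∈ (Algebra.adjoin K T).map (IsScalarTower.toAlgHom K L M) :=
          ⟨l, hl, rfl⟩
        rw [AlgHom.map_adjoin] at this
        refine Algebra.adjoin_mono ?_ this
        rintro _ ⟨τ, hτ, rfl⟩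
        exact hWT ⟨τ, hτ⟩)
    refine (hTalg.isAlgebraic l).ringHom_of_comp_eq f (algebraMap L M) ?_ ?_
    · intro p q hpq
      have : algebraMap L M p = algebraMap L M q := congrArg Subtype.val hpq
      exact Subtype.ext ((algebraMap L M).injective this)
    · rfl
  have hz : ∀ i, IsAlgebraic A (z i) := by
    intro i
    by_cases hi : i ∈ Set.range a
    swap
    · exact hmem _ (hWz i hi)
    obtain ⟨τ, rfl⟩ := hi
    obtain ⟨D, hD⟩ := exists_derivation_of_isTranscendenceBasis hTb τ
    have key := htan D
    rw [← Finset.add_sum_erase _ _ (Finset.mem_univ (a τ)), ha, hD, if_pos rfl, map_one,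
      mul_one] at key
    rw [eq_neg_of_add_eq_zero_left key]
    refine IsAlgebraic.neg ((Subalgebra.algebraicClosure A M).sum_mem fun j hj => ?_)
    change IsAlgebraic A _
    by_cases hjr : j ∈ Set.range a
    · obtain ⟨σ, rfl⟩ := hjr
      have hne : σ ≠ τ := fun h => (Finset.mem_erase.mp hj).1 (by rw [h])
      rw [ha, hD, if_neg hne, map_zero, mul_zero]
      exact isAlgebraic_zero
    · exact (hmem _ (hWz j hjr)).mul (hL _)
  have : Algebra.IsAlgebraic A M := by
    refine isAlgebraic_of_intermediateField_adjoin_eq_top hgen ?_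
    rintro _ (⟨l, rfl⟩ | ⟨i, rfl⟩)
    exacts [hL l, hz i]
  refine (Algebra.IsAlgebraic.trdeg_le_cardinalMk K W).trans ?_
  simpa using Cardinal.mk_range_le_lift (f := fun i =>
    if i ∈ Set.range a then algebraMap L M (y i) else z i)

theorem exists_eq_mul_add_mul_of_det_eq_zero {M : Type*} [Field M] {n : ℕ} {f g h : Fin n → M}
    {a b : Fin n} (hab : f a * g b - f b * g a ≠ 0)
    (hdet : ∀ c : Fin 3 → Fin n, (Matrix.of ![f ∘ c, g ∘ c, h ∘ c]).det = 0) :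
    ∃ α β : M, ∀ j, h j = α * f j + β * g j := by
  refine ⟨(h a * g b - h b * g a) / (f a * g b - f b * g a),
    (f a * h b - f b * h a) / (f a * g b - f b * g a), fun j => ?_⟩
  have := hdet ![a, b, j]
  simp [Matrix.det_fin_three] at this
  rw [div_mul_eq_mul_div, div_mul_eq_mul_div, ← add_div, eq_div_iff hab]
  linear_combination this

theorem trdeg_le_of_isIntegral_gradient {K M : Type*} [Field K] [CharZero K] [Field M]
    [Algebra K M] {n : ℕ} {x z : Fin n → M} {F G : MvPolynomial (Fin n) K}
    (hgen : IntermediateField.adjoin K (Set.range x ∪ Set.range z) = ⊤)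
    (hx : ∀ i, IsIntegral (Algebra.adjoin K (Set.range fun j => pderiv j G))
      (X i : MvPolynomial (Fin n) K))
    (hF : aeval x F = 0) (hG : aeval x G = 0) {a b : Fin n}
    (hab : aeval x (pderiv a F) * aeval x (pderiv b G) -
      aeval x (pderiv b F) * aeval x (pderiv a G) ≠ 0)
    (hdet : ∀ c : Fin 3 → Fin n, (Matrix.of ![(fun j => aeval x (pderiv j F)) ∘ c,
      (fun j => aeval x (pderiv j G)) ∘ c,
      (fun j => ∑ i, z i * aeval x (pderiv j (pderiv i G))) ∘ c]).det = 0) :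
    Algebra.trdeg K M ≤ n := by
  let L := IntermediateField.adjoin K (Set.range x)
  let xL : Fin n → L := fun i => ⟨x i, IntermediateField.subset_adjoin K _ ⟨i, rfl⟩⟩
  have hval : ∀ p : MvPolynomial (Fin n) K, algebraMap L M (aeval xL p) = aeval x p := fun p => by
    rw [← aeval_algebraMap_apply]
    rfl
  let y : Fin n → L := fun i => aeval xL (pderiv i G)
  have hLtop : IntermediateField.adjoin K (Set.range xL) = ⊤ := by
    apply IntermediateField.lift_injective L
    rw [IntermediateField.lift_adjoin, IntermediateField.lift_top, ← Set.range_comp]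
    rfl
  have : Algebra.IsAlgebraic (Algebra.adjoin K (Set.range y)) L := by
    refine isAlgebraic_of_intermediateField_adjoin_eq_top hLtop ?_
    rintro _ ⟨i, rfl⟩
    let f : Algebra.adjoin K (Set.range fun j => pderiv j G) →ₐ[K] Algebra.adjoin K (Set.range y) :=
      ((aeval xL).comp (Algebra.adjoin K _).val).codRestrict _ (by
        rintro ⟨p, hp⟩
        have : aeval xL p ∈
          (Algebra.adjoin K (Set.range fun j => pderiv j G)).map (aeval xL) := ⟨p, hp, rfl⟩
        rw [AlgHom.map_adjoin, ← Set.range_comp] at this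
        exact this)
    have := (hx i).map_of_comp_eq f.toRingHom (aeval xL).toRingHom rfl
    simpa using this.isAlgebraic
  refine trdeg_le_of_forall_derivation y z ?_ fun D => ?_
  · rw [eq_top_iff, ← hgen]
    refine IntermediateField.adjoin.mono K _ _ (Set.union_subset_union_left _ ?_)
    rintro _ ⟨i, rfl⟩
    exact ⟨xL i, rfl⟩
  obtain ⟨α, β, hαβ⟩ := exists_eq_mul_add_mul_of_det_eq_zero hab hdet
  have hchain : ∀ p : MvPolynomial (Fin n) K, algebraMap L M (D (aeval xL p)) =
      ∑ j, aeval x (pderiv j p) * algebraMap L M (D (xL j)) := fun p => by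
    simp only [derivation_aeval, map_sum, map_mul, hval]
  have hzero : ∀ p : MvPolynomial (Fin n) K, aeval x p = 0 →
      ∑ j, aeval x (pderiv j p) * algebraMap L M (D (xL j)) = 0 := fun p hp => by
    rw [← hchain]
    have : aeval xL p = 0 := (algebraMap L M).injective (by rw [hval, hp, map_zero])
    simp [this]
  calc ∑ i, z i * algebraMap L M (D (y i))
      = ∑ j, (∑ i, z i * aeval x (pderiv j (pderiv i G))) * algebraMap L M (D (xL j)) := by
        simp only [y, hchain, Finset.mul_sum, Finset.sum_mul, mul_assoc]
        exact Finset.sum_comm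
    _ = α * ∑ j, aeval x (pderiv j F) * algebraMap L M (D (xL j)) +
        β * ∑ j, aeval x (pderiv j G) * algebraMap L M (D (xL j)) := by
        simp only [hαβ, Finset.mul_sum, ← Finset.sum_add_distrib]
        exact Finset.sum_congr rfl fun j _ => by ring
    _ = 0 := by rw [hzero F hF, hzero G hG]; simp

theorem homogeneousComponent_mul_of_isHomogeneous {K σ : Type*} [CommRing K] {k d : ℕ}
    (hkd : d ≤ k) (a : MvPolynomial σ K) {g : MvPolynomial σ K} (hg : g.IsHomogeneous d) :
    homogeneousComponent k (a * g) = homogeneousComponent (k - d) a * g := by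
  conv_lhs => rw [← sum_homogeneousComponent a, Finset.sum_mul, map_sum]
  have hterm : ∀ i, homogeneousComponent k (homogeneousComponent i a * g) =
      if i = k - d then homogeneousComponent i a * g else 0 := fun i => by
    rw [homogeneousComponent_of_mem ((homogeneousComponent_isHomogeneous i a).mul hg)]
    exact if_congr (by omega) rfl rfl
  simp only [hterm, Finset.sum_ite_eq', Finset.mem_range, Nat.lt_succ_iff]
  split_ifs with h
  · rfl
  · rw [homogeneousComponent_eq_zero _ _ (by omega), zero_mul]

theorem isIntegral_adjoin_of_forall_X_mem {K : Type*} [Field K] {n d : ℕ} (hd : 1 ≤ d)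
    {g : Fin n → MvPolynomial (Fin n) K} (hg : ∀ i, (g i).IsHomogeneous d)
    (hprime : ∀ P : Ideal (MvPolynomial (Fin n) K), P.IsPrime → (∀ i, g i ∈ P) →
      ∀ i, (X i : MvPolynomial (Fin n) K) ∈ P) :
    Algebra.IsIntegral (Algebra.adjoin K (Set.range g)) (MvPolynomial (Fin n) K) := by
  let I := Ideal.span (Set.range g)
  have hrad : idealOfVars (Fin n) K ≤ I.radical := by
    rw [Ideal.radical_eq_sInf, le_sInf_iff]
    rintro P ⟨hIP, hP⟩
    refine Ideal.span_le.mpr ?_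
    rintro _ ⟨i, rfl⟩
    exact hprime P hP (fun j => hIP (Ideal.subset_span ⟨j, rfl⟩)) i
  obtain ⟨N₀, hN₀⟩ := Ideal.exists_pow_le_of_le_radical_of_fg hrad (idealOfVars_fg _ _)
  obtain ⟨N, hdN, hN⟩ : ∃ N, d ≤ N ∧ idealOfVars (Fin n) K ^ N ≤ I :=
    ⟨max N₀ d, le_max_right _ _, (Ideal.pow_le_pow_right (le_max_left _ _)).trans hN₀⟩
  let A := Algebra.adjoin K (Set.range g)
  let gens : Set (MvPolynomial (Fin n) K) := (fun m => monomial m 1) '' {m | m.degree < N}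
  have hhom : ∀ k, ∀ p : MvPolynomial (Fin n) K, p.IsHomogeneous k →
      p ∈ Submodule.span A gens := by
    intro k
    induction k using Nat.strong_induction_on with
    | _ k ih =>
    intro p hp
    have hdeg : ∀ m ∈ p.support, m.degree = k := fun m hm => by
      rw [Finsupp.degree_eq_weight_one]
      exact hp (mem_support_iff.mp hm)
    rcases lt_or_ge k N with hk | hk
    · rw [p.as_sum]
      refine Submodule.sum_mem _ fun m hm => ?_
      have : monomial m (coeff m p) = algebraMap K A (coeff m p) • monomial m (1 : K) := by
        rw [algebraMap_smul, smul_monomial, smul_eq_mul, mul_one]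
      rw [this]
      exact Submodule.smul_mem _ _ (Submodule.subset_span ⟨m, by simpa [hdeg m hm] using hk, rfl⟩)
    · have hpI : p ∈ I := hN ((mem_pow_idealOfVars_iff N p).mpr fun m hm => by
        rwa [hdeg m hm])
      obtain ⟨c, hc⟩ := (Ideal.mem_span_range_iff_exists_fun).mp hpI
      rw [← homogeneousComponent_eq_self hp, ← hc, map_sum]
      refine Submodule.sum_mem _ fun i _ => ?_
      rw [homogeneousComponent_mul_of_isHomogeneous (hdN.trans hk) _ (hg i), mul_comm]
      exact Submodule.smul_mem _ (⟨g i, Algebra.subset_adjoin ⟨i, rfl⟩⟩ : A)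
        (ih (k - d) (by omega) _ (homogeneousComponent_isHomogeneous _ _))
  have : Module.Finite A (MvPolynomial (Fin n) K) := by
    refine ⟨Submodule.fg_def.mpr ⟨gens, (Finsupp.finite_of_degree_lt N).image _, ?_⟩⟩
    rw [eq_top_iff]
    intro p _
    rw [← sum_homogeneousComponent p]
    exact Submodule.sum_mem _ fun k _ => hhom k _ (homogeneousComponent_isHomogeneous _ _)
  exact Algebra.IsIntegral.of_finite _ _

theorem isIntegral_adjoin_pderiv_of_projNonsingular {K : Type*} [Field K] [CharZero K] {n e : ℕ}
    (he : 2 ≤ e) {G : MvPolynomial (Fin n) K} (hG : G.IsHomogeneous e)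
    (hGns : ProjNonsingular ![G]) :
    Algebra.IsIntegral (Algebra.adjoin K (Set.range fun i => pderiv i G))
      (MvPolynomial (Fin n) K) := by
  refine isIntegral_adjoin_of_forall_X_mem (d := e - 1) (by omega) (fun i => hG.pderiv) ?_
  intro P hP hPG
  have hGP : G ∈ P := by
    have h1 : (e : MvPolynomial (Fin n) K) * G ∈ P := by
      rw [← nsmul_eq_mul, ← hG.sum_X_mul_pderiv]
      exact P.sum_mem fun i _ => P.mul_mem_left _ (hPG i)
    refine (hP.mem_or_mem h1).resolve_left fun h2 => hP.ne_top (P.eq_top_of_isUnit_mem h2 ?_)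
    rw [← map_natCast (C : K →+* MvPolynomial (Fin n) K)]
    exact (IsUnit.mk0 (e : K) (by simp; omega)).map C
  refine hGns P hP (Ideal.span_le.mpr ?_)
  rintro _ (⟨i, rfl⟩ | ⟨c, rfl⟩)
  · fin_cases i
    exact hGP
  · simpa [jacMinor] using hPG (c 0)

/-- Specialization of the second block of variables of `K[x, z]` to a point of `K^n`. -/
noncomputable def specialize {K : Type*} [Field K] {n : ℕ} (z : Fin n → K) :
    MvPolynomial (Fin n ⊕ Fin n) K →ₐ[K] MvPolynomial (Fin n) K :=
  aeval (Sum.elim X fun i => C (z i))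

theorem specialize_rename_sumMap {K : Type*} [Field K] {n t a : ℕ} (z : Fin n → K)
    (S : Fin t → Fin n) (B : Fin a → Fin n) (p : MvPolynomial (Fin t ⊕ Fin a) K) :
    specialize z (rename (Sum.map S B) p) =
      rename S (map (eval (z ∘ B)) (sumAlgEquiv K (Fin t) (Fin a) p)) := by
  induction p using MvPolynomial.induction_on with
  | C a => simp [specialize]
  | add p q hp hq => simp only [map_add, hp, hq]
  | mul_X p i hp =>
    simp only [map_mul, hp]
    congr 1
    rcases i with i | i <;> simp [specialize]

theorem specialize_rename_inl {K : Type*} [Field K] {n : ℕ} (z : Fin n → K)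
    (p : MvPolynomial (Fin n) K) : specialize z (rename Sum.inl p) = p := by
  rw [specialize, aeval_rename, Sum.elim_comp_inl, aeval_X_left_apply]

theorem exists_forall_specialize_mem_imp_eq_zero {K : Type*} [Field K] {n t a : ℕ}
    {T : Set (Fin n → K)} {J : (Fin n → K) → Ideal (MvPolynomial (Fin n) K)}
    (hJ : ∀ z ∈ T, (t : WithBot ℕ∞) ≤ ringKrullDim (MvPolynomial (Fin n) K ⧸ J z))
    {B : Fin a → Fin n} (hB : ∀ p : MvPolynomial (Fin a) K, rename B p ∈ vIdeal T → p = 0) :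
    ∃ S : Fin t → Fin n, ∀ p : MvPolynomial (Fin t ⊕ Fin a) K,
      (∀ z ∈ T, specialize z (rename (Sum.map S B) p) ∈ J z) → p = 0 := by
  by_contra! hcon
  choose p hp hne using hcon
  have hcoeff : ∀ S, ∃ m, coeff m (sumAlgEquiv K (Fin t) (Fin a) (p S)) ≠ 0 := fun S =>
    ne_zero_iff.mp ((map_ne_zero_iff _ (AlgEquiv.injective _)).mpr (hne S))
  choose m hm using hcoeff
  have hprod : (∏ S, coeff (m S) (sumAlgEquiv K (Fin t) (Fin a) (p S))) ≠ 0 :=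
    Finset.prod_ne_zero_iff.mpr fun S _ => hm S
  obtain ⟨z, hzT, hz⟩ : ∃ z ∈ T,
      eval z (rename B (∏ S, coeff (m S) (sumAlgEquiv K (Fin t) (Fin a) (p S)))) ≠ 0 := by
    by_contra! hall
    exact hprod (hB _ hall)
  rw [eval_rename, map_prod, Finset.prod_ne_zero_iff] at hz
  obtain ⟨S, hS⟩ := exists_rename_mem_imp_eq_zero_of_le_ringKrullDim (J z) (hJ z hzT)
  have h0 := hS _ (specialize_rename_sumMap z S B (p S) ▸ hp S z hzT)
  apply hz S (Finset.mem_univ S)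
  rw [← coeff_map, h0, coeff_zero]

/-- The universal family of `3 × 3` Jacobian minors of `F`, `G` and `z · ∇G` over `K[x, z]`. -/
noncomputable def universalMinor {K : Type*} [Field K] {n : ℕ} (F G : MvPolynomial (Fin n) K)
    (c : Fin 3 → Fin n) : MvPolynomial (Fin n ⊕ Fin n) K :=
  (Matrix.of ![(fun j => rename Sum.inl (pderiv j F)) ∘ c,
    (fun j => rename Sum.inl (pderiv j G)) ∘ c,
    (fun j => ∑ i, X (Sum.inr i) * rename Sum.inl (pderiv j (pderiv i G))) ∘ c]).det

theorem specialize_universalMinor {K : Type*} [Field K] {n : ℕ} (F G : MvPolynomial (Fin n) K)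
    (z : Fin n → K) (c : Fin 3 → Fin n) :
    specialize z (universalMinor F G c) = jacMinor ![F, G, polY z G] c := by
  rw [universalMinor, jacMinor, AlgHom.map_det]
  congr 1
  ext i j : 2
  fin_cases i
  · simp [specialize_rename_inl]
  · simp [specialize_rename_inl]
  · have hX : ∀ i, specialize z (X (Sum.inr i)) = C (z i) := fun i => by simp [specialize]
    simp [specialize_rename_inl, hX, polY]

theorem exists_minor_not_mem_of_projNonsingular {K : Type*} [Field K] {n : ℕ}
    {F G : MvPolynomial (Fin n) K} (hns : ProjNonsingular ![F, G])
    {P : Ideal (MvPolynomial (Fin n) K)} (hP : P.IsPrime) (hF : F ∈ P) (hG : G ∈ P) {i : Fin n}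
    (hi : (X i : MvPolynomial (Fin n) K) ∉ P) :
    ∃ a b, pderiv a F * pderiv b G - pderiv b F * pderiv a G ∉ P := by
  by_contra! hmin
  refine hi (hns P hP (Ideal.span_le.mpr ?_) i)
  rintro _ (⟨k, rfl⟩ | ⟨c, rfl⟩)
  · fin_cases k
    exacts [hF, hG]
  · simpa [jacMinor, Matrix.det_fin_two] using hmin (c 0) (c 1)

theorem card_add_card_le_of_forall_specialize_mem {K : Type*} [Field K] [CharZero K]
    {n e t a : ℕ} (he : 2 ≤ e) (ht : 1 ≤ t) {F G : MvPolynomial (Fin n) K}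
    (hG : G.IsHomogeneous e) (hYns : ProjNonsingular ![F, G]) (hGns : ProjNonsingular ![G])
    {T : Set (Fin n → K)} {S : Fin t → Fin n} {B : Fin a → Fin n}
    (hSB : ∀ p : MvPolynomial (Fin t ⊕ Fin a) K,
      (∀ z ∈ T, specialize z (rename (Sum.map S B) p) ∈ singIdeal ![F, G, polY z G]) → p = 0) :
    t + a ≤ n := by
  let 𝒥 : Ideal (MvPolynomial (Fin n ⊕ Fin n) K) :=
    ⨅ z ∈ T, (singIdeal ![F, G, polY z G]).comap (specialize z)
  have hmem : ∀ p, p ∈ 𝒥 ↔ ∀ z ∈ T, specialize z p ∈ singIdeal ![F, G, polY z G] := fun p => by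
    simp [𝒥]
  obtain ⟨Q, hQ, hJQ, hdisj⟩ := Ideal.exists_le_prime_disjoint 𝒥
    ((nonZeroDivisors (MvPolynomial (Fin t ⊕ Fin a) K)).map
      (rename (Sum.map S B) : _ →ₐ[K] MvPolynomial (Fin n ⊕ Fin n) K)) (by
      rw [Set.disjoint_left]
      rintro _ h0 ⟨p, hp, rfl⟩
      exact nonZeroDivisors.ne_zero hp (hSB p ((hmem _).mp h0)))
  let M := FractionRing (MvPolynomial (Fin n ⊕ Fin n) K ⧸ Q)
  let v : Fin n ⊕ Fin n → M := fun i => algebraMap _ M (Ideal.Quotient.mk Q (X i))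
  have hv : ∀ p, aeval v p = algebraMap _ M (Ideal.Quotient.mk Q p) := fun p => by
    have : aeval v = (IsScalarTower.toAlgHom K (MvPolynomial (Fin n ⊕ Fin n) K ⧸ Q) M).comp
        (Ideal.Quotient.mkₐ K Q) := by
      ext i
      simp [v]
    rw [this]
    rfl
  have hv0 : ∀ p, aeval v p = 0 ↔ p ∈ Q := fun p => by
    rw [hv, map_eq_zero_iff _ (IsFractionRing.injective _ M), Ideal.Quotient.eq_zero_iff_mem]
  have hind : AlgebraicIndependent K (v ∘ Sum.map S B) := by
    rw [AlgebraicIndependent, injective_iff_map_eq_zero]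
    intro p hp
    rw [← aeval_rename, hv0] at hp
    by_contra hne
    exact Set.disjoint_left.mp hdisj hp ⟨p, mem_nonZeroDivisors_of_ne_zero hne, rfl⟩
  let x : Fin n → M := v ∘ Sum.inl
  let z : Fin n → M := v ∘ Sum.inr
  have hxv : ∀ p : MvPolynomial (Fin n) K, aeval x p = aeval v (rename Sum.inl p) := fun p => by
    rw [aeval_rename]
  have hvan : ∀ k : Fin 3, ∀ p, (∀ z, ![F, G, polY z G] k = p) → aeval x p = 0 := by
    intro k p hp
    rw [hxv, hv0]
    refine hJQ ((hmem _).mpr fun z _ => ?_)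
    rw [specialize_rename_inl]
    exact Ideal.subset_span (Or.inl ⟨k, hp z⟩)
  have hF0 : aeval x F = 0 := hvan 0 F fun _ => rfl
  have hG0 : aeval x G = 0 := hvan 1 G fun _ => rfl
  have hdet : ∀ c : Fin 3 → Fin n, aeval v (universalMinor F G c) = 0 := fun c => by
    rw [hv0]
    refine hJQ ((hmem _).mpr fun z _ => ?_)
    rw [specialize_universalMinor]
    exact Ideal.subset_span (Or.inr ⟨c, rfl⟩)
  have hPmem : ∀ p : MvPolynomial (Fin n) K, p ∈ RingHom.ker (aeval x : _ →ₐ[K] M) ↔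
      aeval x p = 0 := fun p => RingHom.mem_ker
  have hX : (X (S ⟨0, ht⟩) : MvPolynomial (Fin n) K) ∉ RingHom.ker (aeval x : _ →ₐ[K] M) := by
    rw [hPmem, aeval_X]
    exact hind.ne_zero (Sum.inl ⟨0, ht⟩)
  obtain ⟨i, j, hij⟩ := exists_minor_not_mem_of_projNonsingular hYns
    (RingHom.ker_isPrime (aeval x : _ →ₐ[K] M)) ((hPmem F).mpr hF0) ((hPmem G).mpr hG0) hX
  rw [hPmem] at hij
  have hgen : IntermediateField.adjoin K (Set.range x ∪ Set.range z) = ⊤ := by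
    rw [eq_top_iff]
    intro b _
    have hmk : ∀ q : MvPolynomial (Fin n ⊕ Fin n) K ⧸ Q,
        algebraMap _ M q ∈ IntermediateField.adjoin K (Set.range x ∪ Set.range z) := by
      intro q
      obtain ⟨p, rfl⟩ := Ideal.Quotient.mk_surjective q
      rw [← hv]
      refine IntermediateField.algebra_adjoin_le_adjoin K _ ?_
      rw [← Set.Sum.elim_range, Sum.elim_comp_inl_inr]
      rw [← aeval_range]
      exact ⟨p, rfl⟩
    obtain ⟨p, q, -, rfl⟩ := IsFractionRing.div_surjective
      (A := MvPolynomial (Fin n ⊕ Fin n) K ⧸ Q) b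
    exact div_mem (hmk p) (hmk q)
  have hint := isIntegral_adjoin_pderiv_of_projNonsingular he hG hGns
  have htr : Algebra.trdeg K M ≤ n := by
    refine trdeg_le_of_isIntegral_gradient (z := z) hgen (fun i => hint.isIntegral _) hF0 hG0
      (a := i) (b := j) (by simpa using hij) fun c => ?_
    rw [← hdet c, universalMinor, AlgHom.map_det]
    congr 1
    ext k l : 2
    fin_cases k <;> simp [hxv, z]
  have hcard := hind.lift_cardinalMk_le_trdeg.trans (Cardinal.lift_le.mpr htr)
  simp only [Cardinal.mk_sum, Cardinal.mk_fin, Cardinal.lift_add, Cardinal.lift_natCast] at hcard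
  exact_mod_cast hcard

/-- `char K = 0`, `F, G` homogeneous with `deg G ≥ 2`, `n ≥ 3`,
`Y = V(F,G)` a non-singular complete intersection of dimension `n-3` and `V(G)`
non-singular. For `-1 ≤ s ≤ n-3` (written `s = t - 1` with `0 ≤ t ≤ n-2`), the locus
`T_s(F,G)` of `z` with `dim Sing(Diff_z(F,G)) ≥ s` (i.e. the cone over the singular locus
of `V(F,G,G^z)` has dimension `≥ t = s+1`) satisfies `dim T_s(F,G) ≤ n-2-s`,
i.e. its cone has dimension `≤ n-1-s = n-t`. -/
theorem statement9 {K : Type*} [Field K] [CharZero K] {n dF e : ℕ} (hn : 3 ≤ n)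
    (he : 2 ≤ e) (F G : MvPolynomial (Fin n) K)
    (hF : F.IsHomogeneous dF) (hG : G.IsHomogeneous e)
    (hCI : ringKrullDim (MvPolynomial (Fin n) K ⧸ Ideal.span {F, G})
      = ((n - 2 : ℕ) : WithBot ℕ∞))
    (hYns : ProjNonsingular ![F, G]) (hGns : ProjNonsingular ![G]) :
    ∀ t : ℕ, t ≤ n - 2 →
      coneDim {z : Fin n → K |
          (t : WithBot ℕ∞) ≤
            ringKrullDim (MvPolynomial (Fin n) K ⧸ singIdeal ![F, G, polY z G])}
        ≤ ((n - t : ℕ) : WithBot ℕ∞) := by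
  intro t ht
  rcases Nat.eq_zero_or_pos t with rfl | htpos
  · refine (ringKrullDim_quotient_le _).trans ?_
    rw [MvPolynomial.ringKrullDim_of_isNoetherianRing, ringKrullDim_eq_zero_of_field]
    simp
  by_contra hlt
  have hdim := ENat.WithBot.add_one_le_iff.mpr (not_le.mp hlt)
  obtain ⟨B, hB⟩ := exists_rename_mem_imp_eq_zero_of_le_ringKrullDim (m := n - t + 1) _
    (by exact_mod_cast hdim)
  obtain ⟨S, hS⟩ := exists_forall_specialize_mem_imp_eq_zero
    (J := fun z => singIdeal ![F, G, polY z G]) (fun z hz => hz) hB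
  have := card_add_card_le_of_forall_specialize_mem he htpos hG hYns hGns hS
  omega
end

section
/- Let K be a field of characteristic zero and F, G ∈ K[x_1,…,x_n] homogeneous polynomials with deg G ≥ 2, n ≥ 3. Suppose Y = V(F,G) is a complete intersection of dimension n−3. Let Ỹ = V(G) and σ = max{dim Sing Y, dim Sing Ỹ}. Then for −1 ≤ s ≤ n−3, dim T_{σ+s+1}(F,G) ≤ n−2−s, where T_r(F,G) is the locus of z ∈ P^{n-1}_K with dim Sing(V(F,G,G^z)) ≥ r. -/
open MvPolynomial

/-- Krull dimension is invariant under injective integral extensions. -/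
theorem ringKrullDim_eq_of_isIntegral_injective (B A : Type*) [CommRing B] [CommRing A]
    [Algebra B A] [Algebra.IsIntegral B A] (hinj : Function.Injective (algebraMap B A)) :
    ringKrullDim A = ringKrullDim B := by
  apply le_antisymm
  · refine Order.krullDim_le_of_strictMono (PrimeSpectrum.comap (algebraMap B A)) ?_
    intro p q hpq
    exact Ideal.IsIntegral.comap_lt_comap (R := B) (I := p.asIdeal) (J := q.asIdeal) hpq
  · have lift_series : ∀ l : LTSeries (PrimeSpectrum B), ∃ lA : LTSeries (PrimeSpectrum A),
        lA.length = l.length ∧ PrimeSpectrum.comap (algebraMap B A) lA.last = l.last := by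
      intro l
      induction l using RelSeries.inductionOn' with
      | singleton p =>
        obtain ⟨Q, _, hQ, hQp⟩ := Ideal.exists_ideal_over_prime_of_isIntegral (S := A)
          p.asIdeal ⊥ (by
            intro b hb
            have : b = 0 := hinj (by simpa using hb)
            simp [this])
        exact ⟨RelSeries.singleton _ ⟨Q, hQ⟩, rfl, PrimeSpectrum.ext hQp⟩
      | snoc l q hq ih =>
        obtain ⟨lA, hlen, hlast⟩ := ih
        have hlt : l.last < q := hq
        obtain ⟨Q, hle, hQ, hQp⟩ := Ideal.exists_ideal_over_prime_of_isIntegral (S := A)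
          q.asIdeal lA.last.asIdeal (by
            have := congrArg PrimeSpectrum.asIdeal hlast
            simp only [PrimeSpectrum.comap_asIdeal] at this
            rw [this]
            exact hlt.le)
        refine ⟨lA.snoc ⟨Q, hQ⟩ (lt_of_le_of_ne hle ?_), by simp [hlen], ?_⟩
        · intro h
          refine hlt.ne (hlast.symm.trans (PrimeSpectrum.ext ?_))
          rw [PrimeSpectrum.comap_asIdeal, h, hQp]
        · simpa using PrimeSpectrum.ext hQp
    refine iSup_le fun l => ?_
    obtain ⟨lA, hlen, -⟩ := lift_series l
    rw [← hlen]
    exact le_iSup (fun l : LTSeries (PrimeSpectrum A) => (l.length : WithBot ℕ∞)) lA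

/-- The Krull dimension of a finitely generated domain over a field is its transcendence
degree. -/
theorem ringKrullDim_eq_eRank_matroid (K A : Type*) [Field K] [CommRing A] [IsDomain A]
    [Algebra K A] [Algebra.FiniteType K A] :
    ringKrullDim A = ((AlgebraicIndependent.matroid K A).eRank : WithBot ℕ∞) := by
  obtain ⟨s, g, hinj, hint⟩ := exists_integral_inj_algHom_of_fg K A
  let := g.toRingHom.toAlgebra
  have : Algebra.IsIntegral (MvPolynomial (Fin s) K) A := ⟨hint⟩
  have : IsScalarTower K (MvPolynomial (Fin s) K) A :=
    .of_algebraMap_eq fun r => (g.commutes r).symm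
  have : FaithfulSMul (MvPolynomial (Fin s) K) A :=
    (faithfulSMul_iff_algebraMap_injective _ _).mpr hinj
  have hb : IsTranscendenceBasis K
      (algebraMap (MvPolynomial (Fin s) K) A ∘ (X : Fin s → MvPolynomial (Fin s) K)) :=
    (IsTranscendenceBasis.mvPolynomial (Fin s) K).algebraMap_comp
  have hbase := AlgebraicIndependent.matroid_isBase_iff.mpr hb.to_subtype_range
  rw [ringKrullDim_eq_of_isIntegral_injective (MvPolynomial (Fin s) K) A hinj,
    MvPolynomial.ringKrullDim_of_isNoetherianRing, ringKrullDim_eq_zero_of_field,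
    ← hbase.encard_eq_eRank, ← Set.image_univ,
    Function.Injective.encard_image hb.1.injective]
  simp

/-- A finite family contains an algebraically independent subfamily over which all its members
are algebraic. -/
theorem exists_finset_algebraicIndependent_subset_closure (K : Type*) {A ι : Type*} [Field K]
    [CommRing A] [IsDomain A] [Algebra K A] [Finite ι] (v : ι → A) :
    ∃ B : Finset ι, AlgebraicIndependent K (fun i : B => v i) ∧
      Set.range v ⊆ (AlgebraicIndependent.matroid K A).closure (v '' B) := by
  classical
  obtain ⟨I, hI⟩ := (AlgebraicIndependent.matroid K A).exists_isBasis (Set.range v)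
  obtain ⟨s, -, hs⟩ := Set.SurjOn.exists_bijOn_subset
    (s := Set.univ) (t := I) (f := v) (by intro a ha; simpa using hI.subset ha)
  have hfin : s.Finite := Set.toFinite s
  have hind := AlgebraicIndependent.matroid_indep_iff.mp hI.indep
  refine ⟨hfin.toFinset, ?_, ?_⟩
  · exact hind.comp
      (fun i : hfin.toFinset => (⟨v i, hs.mapsTo (hfin.mem_toFinset.mp i.2)⟩ : I)) fun i j hij =>
      Subtype.ext (hs.injOn (hfin.mem_toFinset.mp i.2) (hfin.mem_toFinset.mp j.2)
        (congrArg Subtype.val hij))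
  · rw [Set.Finite.coe_toFinset, hs.image_eq]
    exact hI.subset_closure

/-- An ideal of dimension at least `m` has `m` independent coordinates. -/
theorem exists_finset_forall_mem_eq_zero {K : Type*} [Field K] {n m : ℕ}
    (I : Ideal (MvPolynomial (Fin n) K))
    (h : (m : WithBot ℕ∞) ≤ ringKrullDim (MvPolynomial (Fin n) K ⧸ I)) :
    ∃ S : Finset (Fin n), S.card = m ∧ ∀ f ∈ I, f.vars ⊆ S → f = 0 := by
  classical
  rw [ringKrullDim_quotient, Order.le_krullDim_iff] at h
  obtain ⟨l, rfl⟩ := h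
  set Q := l.head.1.asIdeal with hQ
  have hQp : Q.IsPrime := l.head.1.isPrime
  have hIQ : I ≤ Q := l.head.2
  have hdim : (l.length : WithBot ℕ∞) ≤ ringKrullDim (MvPolynomial (Fin n) K ⧸ Q) := by
    rw [ringKrullDim_quotient, Order.le_krullDim_iff]
    refine ⟨⟨l.length, fun i => ⟨(l i).1, ?_⟩, fun i => l.step i⟩, rfl⟩
    exact (l.head_le i : l.head ≤ l i)
  rw [ringKrullDim_eq_eRank_matroid K] at hdim
  obtain ⟨B, hB, hspan⟩ := exists_finset_algebraicIndependent_subset_closure K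
    (fun i : Fin n => Ideal.Quotient.mk Q (X i))
  have hcard : l.length ≤ B.card := by
    have htop : (AlgebraicIndependent.matroid K (MvPolynomial (Fin n) K ⧸ Q)).closure
        (Set.range fun i : Fin n => Ideal.Quotient.mk Q (X i)) = Set.univ := by
      rw [AlgebraicIndependent.matroid_closure_eq]
      refine Set.eq_univ_of_forall fun a => ?_
      have : a ∈ Algebra.adjoin K (Set.range fun i : Fin n => Ideal.Quotient.mk Q (X i)) := by
        obtain ⟨p, rfl⟩ := Ideal.Quotient.mk_surjective a
        have : Ideal.Quotient.mk Q p = aeval (fun i => Ideal.Quotient.mk Q (X i)) p := by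
          have : Ideal.Quotient.mkₐ K Q = aeval (fun i => Ideal.Quotient.mk Q (X i)) := by
            ext i; simp
          exact DFunLike.congr_fun this p
        rw [this, Algebra.adjoin_range_eq_range_aeval]
        exact ⟨p, rfl⟩
      exact isAlgebraic_algebraMap (⟨a, this⟩ : Algebra.adjoin K _)
    have hle : (AlgebraicIndependent.matroid K (MvPolynomial (Fin n) K ⧸ Q)).eRank ≤ B.card := by
      rw [← Matroid.eRk_univ_eq, ← htop, Matroid.eRk_closure_eq]
      refine ((Matroid.eRk_mono _ hspan).trans_eq (Matroid.eRk_closure_eq _ _)).trans ?_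
      refine (Matroid.eRk_le_encard _ _).trans ((Set.encard_image_le _ _).trans ?_)
      simp
    exact_mod_cast hdim.trans (WithBot.coe_le_coe.mpr hle)
  obtain ⟨S, hSB, hS⟩ := Finset.exists_subset_card_eq hcard
  refine ⟨S, hS, fun f hf hvars => ?_⟩
  have hSind : AlgebraicIndependent K (fun i : S => Ideal.Quotient.mk Q (X i.1)) :=
    hB.comp (fun i : S => (⟨i, hSB i.2⟩ : B)) (fun i j hij =>
      Subtype.ext (congrArg (fun k : B => (k : Fin n)) hij))
  obtain ⟨g, rfl⟩ := exists_rename_eq_of_vars_subset_range f (Subtype.val : S → Fin n)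
    Subtype.val_injective (by simpa using hvars)
  have hg : aeval (fun i : S => Ideal.Quotient.mk Q (X i.1)) g = 0 := by
    have hcomp : (Ideal.Quotient.mkₐ K Q).comp (rename Subtype.val) =
        aeval (fun i : S => Ideal.Quotient.mk Q (X i.1)) := by
      ext i; simp
    rw [← hcomp]
    exact Ideal.Quotient.eq_zero_iff_mem.mpr (hIQ hf)
  rw [hSind.eq_zero_of_aeval_eq_zero g hg, map_zero]

/-- Algebraically independent elements bound the Krull dimension from below. -/
theorem natCard_le_ringKrullDim_of_algebraicIndependent {K A ι : Type*} [Field K] [CommRing A]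
    [IsDomain A] [Algebra K A] [Algebra.FiniteType K A] [Finite ι] {y : ι → A}
    (hy : AlgebraicIndependent K y) : (Nat.card ι : WithBot ℕ∞) ≤ ringKrullDim A := by
  have hle := (AlgebraicIndependent.matroid_indep_iff.mpr hy.to_subtype_range).encard_le_eRank
  rw [← Set.image_univ, Function.Injective.encard_image hy.injective, Set.encard_univ,
    ENat.card_eq_coe_natCard] at hle
  rw [ringKrullDim_eq_eRank_matroid K]
  exact WithBot.coe_le_coe.mpr hle

/-- Over a point of an ideal of dimension at most `u` at most `u` coordinates are independent. -/
theorem card_le_of_algebraicIndependent {K E : Type*} [Field K] [Field E] [Algebra K E] {n u : ℕ}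
    (I : Ideal (MvPolynomial (Fin n) K))
    (h : ringKrullDim (MvPolynomial (Fin n) K ⧸ I) ≤ u) (x : Fin n → E)
    (hx : ∀ f ∈ I, aeval x f = 0) (S : Finset (Fin n))
    (hS : AlgebraicIndependent K (fun i : S => x i)) : S.card ≤ u := by
  have hval : ∀ p : MvPolynomial (Fin n) K, ((aeval fun i =>
      (⟨x i, Algebra.subset_adjoin ⟨i, rfl⟩⟩ : Algebra.adjoin K (Set.range x))) p : E) =
        aeval x p := fun p => by
    have hcomp : (Algebra.adjoin K (Set.range x)).val.comp (aeval fun i =>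
        (⟨x i, Algebra.subset_adjoin ⟨i, rfl⟩⟩ : Algebra.adjoin K (Set.range x))) = aeval x := by
      ext i; simp
    exact DFunLike.congr_fun hcomp p
  have hdim : ringKrullDim (Algebra.adjoin K (Set.range x)) ≤ u := by
    refine (ringKrullDim_le_of_surjective (Ideal.Quotient.lift I
      ((aeval fun i => (⟨x i, Algebra.subset_adjoin ⟨i, rfl⟩⟩ : Algebra.adjoin K (Set.range x)) :
        MvPolynomial (Fin n) K →ₐ[K] _) : _ →+* _) fun f hf => ?_)
      (Ideal.Quotient.lift_surjective_of_surjective _ _ ?_)).trans h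
    · apply Subtype.val_injective
      exact (hval f).trans (hx f hf)
    · rintro ⟨a, ha⟩
      rw [Algebra.adjoin_range_eq_range_aeval] at ha
      obtain ⟨p, rfl⟩ := ha
      exact ⟨p, Subtype.val_injective (hval p)⟩
  have : Algebra.FiniteType K (Algebra.adjoin K (Set.range x)) :=
    .adjoin_of_finite (Set.finite_range x)
  have hind : AlgebraicIndependent K
      (fun i : S => (⟨x i, Algebra.subset_adjoin ⟨i, rfl⟩⟩ : Algebra.adjoin K (Set.range x))) :=
    AlgebraicIndependent.of_comp (Algebra.adjoin K (Set.range x)).val hS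
  have := (natCard_le_ringKrullDim_of_algebraicIndependent hind).trans hdim
  simpa using this

open scoped TensorProduct in
/-- Derivations extend along formally étale algebras. -/
theorem Derivation.exists_extension_of_formallyEtale {R S T : Type*} [CommRing R] [CommRing S]
    [CommRing T] [Algebra R S] [Algebra R T] [Algebra S T] [IsScalarTower R S T]
    [Algebra.FormallyEtale S T]
    (d : Derivation R S T) : ∃ D : Derivation R T T, ∀ s, D (algebraMap S T s) = d s := by
  refine ⟨((d.liftKaehlerDifferential.liftBaseChange T).comp
    (KaehlerDifferential.tensorKaehlerEquivOfFormallyEtale R S T).symm.toLinearMap).compDer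
      (KaehlerDifferential.D R T), fun s => ?_⟩
  simp [KaehlerDifferential.tensorKaehlerEquivOfFormallyEtale_symm_D_algebraMap]

/-- In characteristic zero there are derivations dual to an algebraically independent family. -/
theorem AlgebraicIndependent.exists_derivation {K M ι : Type*} [Field K] [Field M] [CharZero K]
    [Algebra K M] {w : ι → M} (hw : AlgebraicIndependent K w) (i : ι) :
    ∃ D : Derivation K M M, D (w i) = 1 ∧ ∀ j, j ≠ i → D (w j) = 0 := by
  classical
  obtain ⟨s, hws, hs⟩ := exists_isTranscendenceBasis_superset hw.to_subtype_range
  let : Algebra (MvPolynomial s K) M := (aeval ((↑) : s → M)).toAlgebra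
  have : IsScalarTower K (MvPolynomial s K) M :=
    .of_algebraMap_eq fun r => ((aeval ((↑) : s → M)).commutes r).symm
  have : FaithfulSMul (MvPolynomial s K) M :=
    (faithfulSMul_iff_algebraMap_injective _ _).mpr hs.1
  have : CharZero M := charZero_of_injective_algebraMap (algebraMap K M).injective
  have halg : Algebra.IsAlgebraic (MvPolynomial s K) M := by
    have := hs.isAlgebraic
    refine Algebra.IsAlgebraic.of_ringHom_of_comp_eq hs.1.aevalEquiv.toRingEquiv.toRingHom
      (RingHom.id M) hs.1.aevalEquiv.surjective Function.injective_id ?_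
    refine RingHom.ext fun p => ?_
    exact hs.1.algebraMap_aevalEquiv p
  let : Algebra (FractionRing (MvPolynomial s K)) M := FractionRing.liftAlgebra _ _
  have : Algebra.IsAlgebraic (FractionRing (MvPolynomial s K)) M :=
    (IsFractionRing.comap_isAlgebraic_iff (A := MvPolynomial s K)).mp halg
  have : Algebra.FormallyEtale (FractionRing (MvPolynomial s K)) M :=
    .of_isSeparable _ M
  have : Algebra.FormallyEtale (MvPolynomial s K) (FractionRing (MvPolynomial s K)) :=
    .of_isLocalization (nonZeroDivisors _)
  have : Algebra.FormallyEtale (MvPolynomial s K) M :=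
    .comp _ (FractionRing (MvPolynomial s K)) _
  let c : s → M := Pi.single ⟨w i, hws ⟨i, rfl⟩⟩ 1
  obtain ⟨D, hD⟩ := Derivation.exists_extension_of_formallyEtale (mkDerivation K c)
  have hX : ∀ a : s, D a = c a := fun a => by
    have ha : algebraMap (MvPolynomial s K) M (X a) = a := aeval_X ((↑) : s → M) a
    rw [← ha, hD, mkDerivation_X]
  refine ⟨D, (hX ⟨w i, hws ⟨i, rfl⟩⟩).trans (Pi.single_eq_same _ _), fun j hj =>
    (hX ⟨w j, hws ⟨j, rfl⟩⟩).trans (Pi.single_eq_of_ne ?_ _)⟩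
  exact fun h => hj (hw.injective (congrArg Subtype.val h))

/-- Homogeneous components of the product with a homogeneous polynomial. -/
theorem MvPolynomial.homogeneousComponent_mul_of_isHomogeneous {σ R : Type*} [CommRing R]
    (p : MvPolynomial σ R) {q : MvPolynomial σ R} {e : ℕ} (hq : q.IsHomogeneous e) (d : ℕ) :
    homogeneousComponent d (p * q) = if e ≤ d then homogeneousComponent (d - e) p * q else 0 := by
  let := MvPolynomial.gradedAlgebra (σ := σ) (R := R)
  have hdec : ∀ (f : MvPolynomial σ R) (j : ℕ),
      (DirectSum.decompose (homogeneousSubmodule σ R) f j : MvPolynomial σ R) =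
        homogeneousComponent j f := decomposition.decompose'_apply
  have := DirectSum.coe_decompose_mul_of_right_mem (homogeneousSubmodule σ R) (a := p) d hq
  rwa [hdec, hdec] at this

/-- If homogeneous forms of positive degree generate an ideal containing powers of all the
variables, then the polynomial ring is integral over the subalgebra they generate. -/
theorem MvPolynomial.isIntegral_adjoin_of_pow_mem_span {σ κ K : Type*} [Finite σ] [Finite κ]
    [Field K] (g : κ → MvPolynomial σ K) (d : κ → ℕ) (hd : ∀ k, 0 < d k)
    (hg : ∀ k, (g k).IsHomogeneous (d k)) (N : ℕ)
    (hN : ∀ i, (X i : MvPolynomial σ K) ^ N ∈ Ideal.span (Set.range g)) :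
    Algebra.IsIntegral (Algebra.adjoin K (Set.range g)) (MvPolynomial σ K) := by
  classical
  have := Fintype.ofFinite κ
  have := Fintype.ofFinite σ
  set A := Algebra.adjoin K (Set.range g) with hA
  set B : Set (MvPolynomial σ K) := (fun m => monomial m 1) '' {m : σ →₀ ℕ | ∀ i, m i ≤ N} with hB
  have hBfin : B.Finite := by
    refine Set.Finite.image _ ?_
    refine (Set.finite_Iic (Finsupp.equivFunOnFinite.symm fun _ => N)).subset fun m hm i => ?_
    simpa using hm i
  have hC : ∀ (a : K) (p : MvPolynomial σ K), p ∈ Submodule.span A B →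
      C a * p ∈ Submodule.span A B := fun a p hp => by
    have := Submodule.smul_mem _ (algebraMap K A a) hp
    rwa [Algebra.smul_def, ← IsScalarTower.algebraMap_apply] at this
  have key : ∀ (D : ℕ) (f : MvPolynomial σ K), f.IsHomogeneous D → f ∈ Submodule.span A B := by
    intro D
    induction D using Nat.strong_induction_on with
    | _ D ih =>
    intro f hf
    rw [f.as_sum]
    refine Submodule.sum_mem _ fun m hm => ?_
    have hmD : m.degree = D := by
      rw [Finsupp.degree_eq_weight_one]
      exact hf (mem_support_iff.mp hm)
    have hmono : monomial m (coeff m f) = C (coeff m f) * monomial m 1 := by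
      rw [C_mul_monomial, mul_one]
    rw [hmono]
    refine hC _ _ ?_
    by_cases hle : ∀ i, m i ≤ N
    · exact Submodule.subset_span ⟨m, hle, rfl⟩
    push Not at hle
    obtain ⟨i, hi⟩ := hle
    have hmem : (monomial m (1 : K)) ∈ Ideal.span (Set.range g) := by
      have : (monomial m (1 : K)) = monomial (m - Finsupp.single i N) 1 * X i ^ N := by
        rw [X_pow_eq_monomial, monomial_mul, one_mul, tsub_add_cancel_of_le]
        simpa using hi.le
      rw [this]
      exact Ideal.mul_mem_left _ _ (hN i)
    obtain ⟨c, hc⟩ := Ideal.mem_span_range_iff_exists_fun.mp hmem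
    have hhom : (monomial m (1 : K)).IsHomogeneous D := isHomogeneous_monomial _ hmD
    rw [← homogeneousComponent_eq_self hhom, ← hc, map_sum]
    refine Submodule.sum_mem _ fun k _ => ?_
    rw [homogeneousComponent_mul_of_isHomogeneous _ (hg k)]
    split_ifs with hk
    · have := Submodule.smul_mem _ (⟨g k, Algebra.subset_adjoin ⟨k, rfl⟩⟩ : A)
        (ih (D - d k) (by have := hd k; omega) _ (homogeneousComponent_isHomogeneous _ (c k)))
      rwa [Algebra.smul_def, mul_comm] at this
    · exact Submodule.zero_mem _
  have htop : Submodule.span A B = ⊤ := by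
    refine eq_top_iff.mpr fun f _ => ?_
    rw [← sum_homogeneousComponent f]
    exact Submodule.sum_mem _ fun D _ => key D _ (homogeneousComponent_isHomogeneous _ _)
  have : Module.Finite A (MvPolynomial σ K) := ⟨Submodule.fg_def.mpr ⟨B, hBfin, htop⟩⟩
  exact Algebra.IsIntegral.of_finite _ _

/-- The Krull dimension of a quotient is at most `u` if and only if chains of primes containing the
ideal have length at most `u`. -/
theorem ringKrullDim_quotient_le_iff {R : Type*} [CommRing R] (I : Ideal R) (u : ℕ) :
    ringKrullDim (R ⧸ I) ≤ u ↔
      ∀ l : LTSeries (PrimeSpectrum R), I ≤ l.head.asIdeal → l.length ≤ u := by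
  rw [ringKrullDim_quotient, ← ENat.WithBot.lt_add_one_iff, ← Nat.cast_one, ← Nat.cast_add,
    Order.krullDim_lt_coe_iff]
  constructor
  · intro h l hl
    exact Nat.lt_succ_iff.mp (h ⟨l.length, fun i => ⟨l i, hl.trans (l.head_le i)⟩, l.step⟩)
  · intro h l
    exact Nat.lt_succ_iff.mpr (h (l.map Subtype.val fun _ _ h => h) l.head.2)

/-- A prime ideal containing all the variables is maximal. -/
theorem MvPolynomial.eq_of_le_of_X_mem {σ K : Type*} [Field K] {p q : Ideal (MvPolynomial σ K)}
    (hq : q ≠ ⊤) (hpq : p ≤ q) (hX : ∀ i, X i ∈ p) : p = q := by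
  refine le_antisymm hpq fun f hf => ?_
  have hmk : Ideal.Quotient.mk p =
      (Ideal.Quotient.mk p).comp (C.comp (constantCoeff : MvPolynomial σ K →+* K)) := by
    refine ringHom_ext (fun a => by simp) fun i => ?_
    simpa using Ideal.Quotient.eq_zero_iff_mem.mpr (hX i)
  have hsub : f - C (constantCoeff f) ∈ p :=
    Ideal.Quotient.eq.mp (DFunLike.congr_fun hmk f)
  have hC : C (constantCoeff f) ∈ q := by
    simpa using q.sub_mem hf (hpq hsub)
  have hzero : constantCoeff f = 0 := by
    by_contra hne
    exact hq (Ideal.eq_top_of_isUnit_mem _ hC ((isUnit_iff_ne_zero.mpr hne).map C))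
  simpa [hzero] using hsub

/-- A generic linear form cuts down the dimension of an ideal. -/
theorem MvPolynomial.exists_isHomogeneous_one_ringKrullDim_le {σ K : Type*} [Finite σ] [Field K]
    [Infinite K] (I : Ideal (MvPolynomial σ K)) (u : ℕ)
    (h : ringKrullDim (MvPolynomial σ K ⧸ I) ≤ (u + 1 : ℕ)) :
    ∃ l : MvPolynomial σ K, l.IsHomogeneous 1 ∧
      ringKrullDim (MvPolynomial σ K ⧸ (I ⊔ Ideal.span {l})) ≤ u := by
  classical
  have := Fintype.ofFinite σ
  let W : Ideal (MvPolynomial σ K) → Submodule K (σ → K) := fun q =>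
    (q.restrictScalars K).comap (Fintype.linearCombination K (X : σ → MvPolynomial σ K))
  have hfin : (I.minimalPrimes \ {q | ∀ i, X i ∈ q}).Finite :=
    (Ideal.finite_minimalPrimes_of_isNoetherianRing _ I).subset Set.sdiff_subset
  have htop : ⊤ ∉ hfin.toFinset.image W := by
    intro hmem
    obtain ⟨q, hq, hWq⟩ := Finset.mem_image.mp hmem
    refine ((hfin.mem_toFinset).mp hq).2 fun i => ?_
    have : Pi.single i 1 ∈ W q := hWq ▸ Submodule.mem_top
    simpa [W] using this
  obtain ⟨c, hc⟩ := (Set.ne_univ_iff_exists_notMem _).mp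
    (Subspace.biUnion_ne_univ_of_top_notMem htop)
  refine ⟨Fintype.linearCombination K X c, ?_, ?_⟩
  · rw [Fintype.linearCombination_apply]
    refine IsHomogeneous.sum _ _ _ fun i _ => ?_
    rw [smul_eq_C_mul]
    simpa using (isHomogeneous_C σ (c i)).mul (isHomogeneous_X K i)
  · rw [ringKrullDim_quotient_le_iff] at h ⊢
    intro s hs
    obtain ⟨q, hq, hqs⟩ := Ideal.exists_minimalPrimes_le (le_sup_left.trans hs)
    have hqp : q.IsPrime := hq.1.1
    rcases hqs.lt_or_eq with hlt | heq
    · have := h (s.cons ⟨q, hqp⟩ hlt) (by simpa using hq.1.2)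
      simpa using this
    · have hX : ∀ i, X i ∈ q := by
        by_contra hne
        refine hc (Set.mem_biUnion (x := W q) ?_ ?_)
        · exact Finset.mem_image_of_mem _ (hfin.mem_toFinset.mpr ⟨hq, hne⟩)
        · change Fintype.linearCombination K X c ∈ q
          rw [heq]
          exact hs (Ideal.mem_sup_right (Ideal.mem_span_singleton_self _))
      by_contra hlen
      have h0 : 0 < s.length := by omega
      have hlt : s.head < s.last := by
        exact s.strictMono (by simp [Fin.lt_def]; omega)
      exact hlt.ne (PrimeSpectrum.ext (eq_of_le_of_X_mem s.last.isPrime.ne_top hlt.le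
        (heq ▸ hX)))

/-- A homogeneous ideal of dimension at most `u` becomes primary to the irrelevant ideal after
adding `u` suitable linear forms. -/
theorem MvPolynomial.exists_linearForms_pow_mem {σ K : Type*} [Finite σ] [Field K] [Infinite K]
    (u : ℕ) (I : Ideal (MvPolynomial σ K)) (hI : ∀ f ∈ I, ∀ d, homogeneousComponent d f ∈ I)
    (h : ringKrullDim (MvPolynomial σ K ⧸ I) ≤ u) :
    ∃ (l : Fin u → MvPolynomial σ K) (N : ℕ), (∀ j, (l j).IsHomogeneous 1) ∧
      ∀ i, X i ^ N ∈ I ⊔ Ideal.span (Set.range l) := by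
  classical
  have := Fintype.ofFinite σ
  induction u generalizing I with
  | zero =>
    have : Ring.KrullDimLE 0 (MvPolynomial σ K ⧸ I) :=
      Ring.krullDimLE_iff.mpr h
    have : IsArtinianRing (MvPolynomial σ K ⧸ I) := isArtinianRing_iff_krullDimLE_zero.mpr this
    have hpow : ∀ i, ∃ k, X i ^ k ∈ I := fun i => by
      obtain ⟨k, y, hy⟩ := IsArtinian.exists_pow_succ_smul_dvd
        (R := MvPolynomial σ K ⧸ I) (Ideal.Quotient.mk I (X i))
        (1 : MvPolynomial σ K ⧸ I)
      obtain ⟨f, rfl⟩ := Ideal.Quotient.mk_surjective y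
      refine ⟨k, ?_⟩
      have hmem : X i ^ k - f * X i ^ (k + 1) ∈ I := by
        rw [← Ideal.Quotient.eq_zero_iff_mem, map_sub, sub_eq_zero]
        simp only [smul_eq_mul, mul_one] at hy
        rw [map_mul, map_pow, map_pow, ← hy, mul_comm]
      have := hI _ hmem k
      rwa [map_sub, homogeneousComponent_mul_of_isHomogeneous _ (isHomogeneous_X_pow i (k + 1)),
        if_neg (by omega), sub_zero, homogeneousComponent_eq_self (isHomogeneous_X_pow i k)] at this
    choose k hk using hpow
    refine ⟨Fin.elim0, ∑ i, k i, fun j => j.elim0, fun i => Ideal.mem_sup_left ?_⟩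
    exact I.pow_mem_of_pow_mem (hk i) (Finset.single_le_sum (fun _ _ => Nat.zero_le _)
      (Finset.mem_univ i))
  | succ u ih =>
    obtain ⟨l₀, hl₀, hdim⟩ := exists_isHomogeneous_one_ringKrullDim_le I u h
    have hhom : ∀ f ∈ I ⊔ Ideal.span {l₀}, ∀ d,
        homogeneousComponent d f ∈ I ⊔ Ideal.span {l₀} := fun f hf d => by
      obtain ⟨a, ha, b, hb, rfl⟩ := Submodule.mem_sup.mp hf
      obtain ⟨b, rfl⟩ := Ideal.mem_span_singleton'.mp hb
      rw [map_add, homogeneousComponent_mul_of_isHomogeneous _ hl₀]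
      refine Ideal.add_mem _ (Ideal.mem_sup_left (hI a ha d)) (Ideal.mem_sup_right ?_)
      split_ifs
      · exact Ideal.mul_mem_left _ _ (Ideal.mem_span_singleton_self _)
      · exact Ideal.zero_mem _
    obtain ⟨l, N, hl, hN⟩ := ih _ hhom hdim
    refine ⟨Fin.cons l₀ l, N, Fin.cases hl₀ hl, fun i => ?_⟩
    have := hN i
    rwa [sup_assoc, ← Ideal.span_union, Set.singleton_union, ← Fin.range_cons] at this

/-- The chain rule for derivations of polynomial expressions. -/
theorem Derivation.apply_aeval_eq_sum {R A M σ : Type*} [CommRing R] [CommRing A] [AddCommGroup M]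
    [Algebra R A] [Module R M] [Module A M] [IsScalarTower R A M] [Fintype σ]
    (D : Derivation R A M) (x : σ → A) (p : MvPolynomial σ R) :
    D (aeval x p) = ∑ i, aeval x (pderiv i p) • D (x i) := by
  classical
  induction p using MvPolynomial.induction_on with
  | C a => simp
  | add p q hp hq => simp [hp, hq, add_smul, Finset.sum_add_distrib]
  | mul_X p i hp =>
    simp [hp, add_smul, Finset.sum_add_distrib, pderiv_X, Pi.single_apply, Finset.smul_sum,
      smul_smul, Derivation.leibniz, apply_ite, ite_smul, mul_comm, add_comm]

/-- Flats of the algebraic matroid of a field extension are relatively algebraically closed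
subfields. -/
theorem exists_intermediateField_eq_closure (K : Type*) {E : Type*} [Field K] [Field E]
    [Algebra K E] (s : Set E) :
    ∃ L : IntermediateField K E, (L : Set E) = (AlgebraicIndependent.matroid K E).closure s ∧
      ∀ y : E, IsAlgebraic L y → y ∈ L := by
  let S := (Subalgebra.algebraicClosure (Algebra.adjoin K s) E).restrictScalars K
  refine ⟨{ S with inv_mem' := fun y hy => ?_ }, ?_, fun y hy => ?_⟩
  · exact IsAlgebraic.inv (R := Algebra.adjoin K s) hy
  · rw [AlgebraicIndependent.matroid_closure_eq]
    rfl
  · have hy' : IsAlgebraic (Subalgebra.algebraicClosure (Algebra.adjoin K s) E) y := hy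
    exact hy'.restrictScalars (Algebra.adjoin K s)

/-- A point lies in a relatively algebraically closed subfield as soon as the values of
homogeneous forms defining the irrelevant ideal up to radical do. -/
theorem mem_intermediateField_of_aeval_mem {σ κ K E : Type*} [Finite σ] [Finite κ]
    [Field K] [Field E] [Algebra K E] (g : κ → MvPolynomial σ K) (d : κ → ℕ) (hd : ∀ k, 0 < d k)
    (hg : ∀ k, (g k).IsHomogeneous (d k)) (N : ℕ)
    (hN : ∀ i, (X i : MvPolynomial σ K) ^ N ∈ Ideal.span (Set.range g))
    (L : IntermediateField K E) (hL : ∀ y : E, IsAlgebraic L y → y ∈ L) (x : σ → E)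
    (hx : ∀ k, aeval x (g k) ∈ L) (i : σ) : x i ∈ L := by
  have hint := (isIntegral_adjoin_of_pow_mem_span g d hd hg N hN).isIntegral (X i)
  have hle : Algebra.adjoin K (Set.range g) ≤ L.toSubalgebra.comap (aeval x) :=
    Algebra.adjoin_le (by rintro _ ⟨k, rfl⟩; exact hx k)
  let φ : Algebra.adjoin K (Set.range g) →ₐ[K] L :=
    ((aeval x).comp (Algebra.adjoin K (Set.range g)).val).codRestrict L.toSubalgebra
      fun a => hle a.2
  have := hint.map_of_comp_eq φ.toRingHom (aeval x : MvPolynomial σ K →ₐ[K] E).toRingHom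
    (RingHom.ext fun a => rfl)
  refine hL _ (IsIntegral.isAlgebraic ?_)
  simpa using this

/-- An algebraically independent family in the closure of a finite set is at most as large. -/
theorem natCard_le_of_mem_closure {K E ι : Type*} [Field K] [Field E] [Algebra K E] [Finite ι]
    {y : ι → E} (hy : AlgebraicIndependent K y) {s : Set E} {c : ℕ} (hs : s.encard ≤ c)
    (hys : ∀ i, y i ∈ (AlgebraicIndependent.matroid K E).closure s) : Nat.card ι ≤ c := by
  have hle := (AlgebraicIndependent.matroid_indep_iff.mpr
    hy.to_subtype_range).encard_le_eRk_of_subset (Set.range_subset_iff.mpr hys)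
  rw [Matroid.eRk_closure_eq, ← Set.image_univ, Function.Injective.encard_image hy.injective,
    Set.encard_univ, ENat.card_eq_coe_natCard] at hle
  exact_mod_cast hle.trans ((Matroid.eRk_le_encard _ _).trans hs)

/-- If the first two rows of a matrix of rank two are independent, the third is orthogonal to
their common kernel. -/
theorem sum_mul_eq_zero_of_det_eq_zero {E ι : Type*} [Field E] [Fintype ι] (a b h w : ι → E)
    (hdet : ∀ c : Fin 3 → ι, (Matrix.of ![a ∘ c, b ∘ c, h ∘ c]).det = 0) {i j : ι}
    (hij : a i * b j - a j * b i ≠ 0) (ha : ∑ k, a k * w k = 0) (hb : ∑ k, b k * w k = 0) :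
    ∑ k, h k * w k = 0 := by
  have hk : ∀ k, (a i * b j - a j * b i) * h k =
      b k * (a i * h j - a j * h i) - a k * (b i * h j - b j * h i) := fun k => by
    have := hdet ![i, j, k]
    rw [Matrix.det_fin_three] at this
    simp at this
    linear_combination this
  refine (mul_eq_zero.mp ?_).resolve_left hij
  calc (a i * b j - a j * b i) * ∑ k, h k * w k
      = ∑ k, ((a i * b j - a j * b i) * h k) * w k := by
        rw [Finset.mul_sum]; exact Finset.sum_congr rfl fun k _ => by ring
    _ = (a i * h j - a j * h i) * ∑ k, b k * w k -
          (b i * h j - b j * h i) * ∑ k, a k * w k := by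
        rw [Finset.mul_sum, Finset.mul_sum, ← Finset.sum_sub_distrib]
        exact Finset.sum_congr rfl fun k _ => by rw [hk]; ring
    _ = 0 := by rw [ha, hb]; ring

/-- The coordinates of `z` indexed by algebraically independent partial derivatives of `G` at `x`
are rational functions of the others and of `x`, when `G^z` is singular along `V(F, G)` at `x`. -/
theorem mem_of_algebraicIndependent_pderiv {σ K E : Type*} [Fintype σ] [Field K] [CharZero K]
    [Field E] [Algebra K E] (F G : MvPolynomial σ K) (x z : σ → E) (hF : aeval x F = 0)
    (hG : aeval x G = 0)
    (hw : ∀ w : σ → E, ∑ j, aeval x (pderiv j F) * w j = 0 → ∑ j, aeval x (pderiv j G) * w j = 0 →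
      ∑ j, (∑ i, z i * aeval x (pderiv j (pderiv i G))) * w j = 0)
    (B : Finset σ) (hB : AlgebraicIndependent K (fun i : B => aeval x (pderiv i.1 G)))
    (L : IntermediateField K E) (hx : ∀ i, x i ∈ L) (hz : ∀ i ∉ B, z i ∈ L) (i : σ) : z i ∈ L := by
  classical
  by_cases hi : i ∈ B
  swap
  · exact hz i hi
  set M := IntermediateField.adjoin K (Set.range x)
  have hML : M ≤ L := IntermediateField.adjoin_le_iff.mpr (Set.range_subset_iff.mpr hx)
  let y : σ → M := fun j => ⟨x j, IntermediateField.subset_adjoin K _ ⟨j, rfl⟩⟩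
  have hval : ∀ p : MvPolynomial σ K, ((aeval y p : M) : E) = aeval x p := fun p => by
    have hcomp : M.val.comp (aeval y) = aeval x := by
      ext j; simp [y]
    exact DFunLike.congr_fun hcomp p
  have hBM : AlgebraicIndependent K (fun i : B => aeval y (pderiv i.1 G)) := by
    refine AlgebraicIndependent.of_comp M.val ?_
    convert! hB using 2 with k
    exact hval _
  obtain ⟨D, hD1, hD0⟩ := hBM.exists_derivation ⟨i, hi⟩
  have hchain : ∀ p : MvPolynomial σ K,
      ((D (aeval y p) : M) : E) = ∑ j, aeval x (pderiv j p) * (D (y j) : E) := fun p => by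
    rw [D.apply_aeval_eq_sum]
    simp [hval]
  have hzero : ∀ p : MvPolynomial σ K, aeval x p = 0 →
      ∑ j, aeval x (pderiv j p) * (D (y j) : E) = 0 := fun p hp => by
    have : aeval y p = 0 := Subtype.val_injective ((hval p).trans hp)
    rw [← hchain, this, map_zero]
    rfl
  have hsum : ∑ k, z k * (D (aeval y (pderiv k G)) : E) = 0 := by
    rw [← hw (fun j => D (y j)) (hzero F hF) (hzero G hG)]
    simp_rw [hchain, Finset.mul_sum, Finset.sum_mul]
    rw [Finset.sum_comm]
    simp_rw [mul_assoc]
  rw [← Finset.add_sum_erase _ _ (Finset.mem_univ i), hD1] at hsum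
  have hsolve : z i = -∑ k ∈ Finset.univ.erase i, z k * (D (aeval y (pderiv k G)) : E) := by
    simpa using eq_neg_of_add_eq_zero_left hsum
  rw [hsolve]
  refine neg_mem (sum_mem fun k hk => ?_)
  by_cases hkB : k ∈ B
  · rw [hD0 ⟨k, hkB⟩ fun h => (Finset.mem_erase.mp hk).1 (congrArg Subtype.val h)]
    simp
  · exact mul_mem (hz k hkB) (hML (D (aeval y (pderiv k G))).2)

/-- An ideal generated by finitely many homogeneous polynomials is stable under taking homogeneous
components. -/
theorem MvPolynomial.homogeneousComponent_mem_span_range {σ κ K : Type*} [Finite κ] [CommRing K]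
    (g : κ → MvPolynomial σ K) (d : κ → ℕ) (hg : ∀ k, (g k).IsHomogeneous (d k))
    {f : MvPolynomial σ K} (hf : f ∈ Ideal.span (Set.range g)) (m : ℕ) :
    homogeneousComponent m f ∈ Ideal.span (Set.range g) := by
  have := Fintype.ofFinite κ
  obtain ⟨c, rfl⟩ := Ideal.mem_span_range_iff_exists_fun.mp hf
  rw [map_sum]
  refine Ideal.sum_mem _ fun k _ => ?_
  rw [homogeneousComponent_mul_of_isHomogeneous _ (hg k)]
  split_ifs
  · exact Ideal.mul_mem_left _ _ (Ideal.subset_span ⟨k, rfl⟩)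
  · exact Ideal.zero_mem _

theorem singIdeal_singleton_eq {K : Type*} [Field K] {n : ℕ} (G : MvPolynomial (Fin n) K) :
    singIdeal ![G] =
      Ideal.span (Set.range (Sum.elim (fun _ : Unit => G) fun i => pderiv i G)) := by
  have hG : Set.range ![G] = Set.range fun _ : Unit => G := by
    simp
  have hminor : Set.range (jacMinor ![G]) = Set.range fun i => pderiv i G := by
    ext f
    constructor
    · rintro ⟨c, rfl⟩
      exact ⟨c 0, by simp [jacMinor]⟩
    · rintro ⟨i, rfl⟩
      exact ⟨fun _ => i, by simp [jacMinor]⟩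
  rw [singIdeal, hG, hminor, Set.Sum.elim_range]

/-- Dimension count for pairs `(x, z)` such that `V(F, G, G^z)` is singular at `x`. -/
theorem card_add_card_le_of_algebraicIndependent {K E : Type*} [Field K] [CharZero K] [Field E]
    [Algebra K E] {n e u : ℕ} (he : 2 ≤ e) (F G : MvPolynomial (Fin n) K)
    (hG : G.IsHomogeneous e)
    (hsY : ringKrullDim (MvPolynomial (Fin n) K ⧸ singIdeal ![F, G]) ≤ (u : WithBot ℕ∞))
    (hsG : ringKrullDim (MvPolynomial (Fin n) K ⧸ singIdeal ![G]) ≤ (u : WithBot ℕ∞))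
    (x z : Fin n → E) (hFx : aeval x F = 0) (hGx : aeval x G = 0)
    (hdet : ∀ c : Fin 3 → Fin n, (Matrix.of ![(fun j => aeval x (pderiv j F)) ∘ c,
      (fun j => aeval x (pderiv j G)) ∘ c,
      (fun j => ∑ i, z i * aeval x (pderiv j (pderiv i G))) ∘ c]).det = 0)
    (Sx Sz : Finset (Fin n)) (hu : u < Sx.card)
    (hind : AlgebraicIndependent K (Sum.elim (fun i : Sx => x i) fun i : Sz => z i)) :
    Sx.card + Sz.card ≤ n + u := by
  classical
  obtain ⟨i, j, hij⟩ : ∃ i j, aeval x (pderiv i F) * aeval x (pderiv j G) -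
      aeval x (pderiv j F) * aeval x (pderiv i G) ≠ 0 := by
    by_contra! hminor
    refine hu.not_ge (card_le_of_algebraicIndependent _ hsY x ?_ Sx
      (hind.comp Sum.inl Sum.inl_injective))
    have hle : singIdeal ![F, G] ≤ RingHom.ker (aeval x : MvPolynomial (Fin n) K →ₐ[K] E) := by
      refine Ideal.span_le.mpr (Set.union_subset ?_ ?_)
      · rintro _ ⟨k, rfl⟩
        fin_cases k
        · exact hFx
        · exact hGx
      · rintro _ ⟨c, rfl⟩
        simpa [jacMinor, Matrix.det_fin_two] using hminor (c 0) (c 1)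
    exact fun f hf => hle hf
  obtain ⟨B, hB, hBspan⟩ := exists_finset_algebraicIndependent_subset_closure K
    (fun i : Fin n => aeval x (pderiv i G))
  have hgen : ∀ k, (Sum.elim (fun _ : Unit => G) (fun i => pderiv i G) k).IsHomogeneous
      (Sum.elim (fun _ : Unit => e) (fun _ : Fin n => e - 1) k) := by
    rintro (_ | k)
    · exact hG
    · exact hG.pderiv
  rw [singIdeal_singleton_eq] at hsG
  obtain ⟨l, N, hl, hN⟩ := exists_linearForms_pow_mem u _
    (fun f hf d => homogeneousComponent_mem_span_range _ _ hgen hf d) hsG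
  set s : Set E := (fun i => aeval x (pderiv i G)) '' B ∪ (Set.range fun k => aeval x (l k)) ∪
    z '' (Bᶜ : Finset (Fin n)) with hs
  have hcard : s.encard ≤ (n + u : ℕ) := by
    refine (Set.encard_union_le _ _).trans ?_
    have h1 := (Set.encard_union_le ((fun i => aeval x (pderiv i G)) '' B)
      (Set.range fun k => aeval x (l k)))
    have h2 : ((fun i => aeval x (pderiv i G)) '' (B : Set (Fin n))).encard ≤ B.card :=
      (Set.encard_image_le _ _).trans (by simp)
    have h3 : (Set.range fun k => aeval x (l k)).encard ≤ u := by
      rw [← Set.image_univ]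
      exact (Set.encard_image_le _ _).trans (by simp)
    have h4 : (z '' ((Bᶜ : Finset (Fin n)) : Set (Fin n))).encard ≤ (Bᶜ).card :=
      (Set.encard_image_le _ _).trans (Set.encard_coe_eq_coe_finsetCard _).le
    refine (add_le_add (h1.trans (add_le_add h2 h3)) h4).trans ?_
    have : B.card + Bᶜ.card = n := by simp
    norm_cast
    omega
  obtain ⟨L, hLs, hL⟩ := exists_intermediateField_eq_closure K s
  have hsL : s ⊆ L := hLs ▸ (AlgebraicIndependent.matroid K E).subset_closure s
  have hv : ∀ i, aeval x (pderiv i G) ∈ L := fun i => by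
    have : aeval x (pderiv i G) ∈ (L : Set E) := by
      rw [hLs]
      exact (AlgebraicIndependent.matroid K E).closure_subset_closure
        (Set.subset_union_left.trans Set.subset_union_left) (hBspan ⟨i, rfl⟩)
    exact this
  have hxL : ∀ i, x i ∈ L := by
    refine mem_intermediateField_of_aeval_mem
      (Sum.elim (Sum.elim (fun _ : Unit => G) fun i => pderiv i G) l)
      (Sum.elim (Sum.elim (fun _ : Unit => e) fun _ : Fin n => e - 1) fun _ => 1) ?_ ?_ N ?_ L hL
      x ?_
    · rintro ((_ | _) | _) <;> simp <;> omega
    · rintro (k | k)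
      · exact hgen k
      · exact hl k
    · intro i
      rw [Set.Sum.elim_range, Ideal.span_union]
      exact hN i
    · rintro ((_ | k) | k)
      · simp [hGx]
      · exact hv k
      · exact hsL (Or.inl (Or.inr ⟨k, rfl⟩))
  have hzL : ∀ i, z i ∈ L := mem_of_algebraicIndependent_pderiv F G x z hFx hGx
    (fun w => sum_mul_eq_zero_of_det_eq_zero _ _ _ w hdet hij) B hB L hxL
    fun i hi => hsL (Or.inr ⟨i, by simpa using hi, rfl⟩)
  have := natCard_le_of_mem_closure hind hcard (by
    rw [← hLs]
    rintro (i | i)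
    · exact hxL i
    · exact hzL i)
  simpa using this

/-- A quotient has Krull dimension at least `d` if and only if there is a chain of primes of
length `d` containing the ideal. -/
theorem natCast_le_ringKrullDim_quotient_iff {R : Type*} [CommRing R] (I : Ideal R) (d : ℕ) :
    (d : WithBot ℕ∞) ≤ ringKrullDim (R ⧸ I) ↔
      ∃ l : LTSeries (PrimeSpectrum R), l.length = d ∧ I ≤ l.head.asIdeal := by
  rw [ringKrullDim_quotient, Order.le_krullDim_iff]
  constructor
  · rintro ⟨l, rfl⟩
    exact ⟨l.map Subtype.val fun _ _ h => h, rfl, l.head.2⟩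
  · rintro ⟨l, rfl, hl⟩
    exact ⟨⟨l.length, fun i => ⟨l i, hl.trans (l.head_le i)⟩, l.step⟩, rfl⟩

/-- A set of points contains a subset with prime vanishing ideal of at least the same
dimension. -/
theorem exists_subset_isPrime_vIdeal {K : Type*} [Field K] {n d : ℕ} (T : Set (Fin n → K))
    (h : (d : WithBot ℕ∞) ≤ ringKrullDim (MvPolynomial (Fin n) K ⧸ vIdeal T)) :
    ∃ T' ⊆ T, (vIdeal T').IsPrime ∧
      (d : WithBot ℕ∞) ≤ ringKrullDim (MvPolynomial (Fin n) K ⧸ vIdeal T') := by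
  let 𝒮 : Set (Ideal (MvPolynomial (Fin n) K)) := {I | ∃ T' ⊆ T, I = vIdeal T' ∧
    (d : WithBot ℕ∞) ≤ ringKrullDim (MvPolynomial (Fin n) K ⧸ I)}
  obtain ⟨I, ⟨T', hT', rfl, hdim⟩, hmax⟩ := set_has_maximal_iff_noetherian.mpr
    (inferInstance : IsNoetherianRing (MvPolynomial (Fin n) K)) 𝒮 ⟨_, T, subset_rfl, rfl, h⟩
  refine ⟨T', hT', ?_, hdim⟩
  obtain ⟨l, hl, hle⟩ := (natCast_le_ringKrullDim_quotient_iff _ d).mp hdim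
  have mem_of_le : ∀ f, vIdeal {z ∈ T' | eval z f = 0} ≤ l.head.asIdeal → f ∈ vIdeal T' := by
    intro f hf
    have hmem : vIdeal {z ∈ T' | eval z f = 0} ∈ 𝒮 :=
      ⟨_, (Set.sep_subset _ _).trans hT', rfl,
        (natCast_le_ringKrullDim_quotient_iff _ d).mpr ⟨l, hl, hf⟩⟩
    have hsub : vIdeal T' ≤ vIdeal {z ∈ T' | eval z f = 0} := fun p hp z hz => hp z hz.1
    rw [hsub.eq_of_not_lt (hmax _ hmem)]
    exact fun z hz => hz.2
  refine ⟨fun htop => l.head.isPrime.ne_top (top_le_iff.mp (htop ▸ hle)), fun {f g} hfg => ?_⟩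
  have hmul : vIdeal {z ∈ T' | eval z f = 0} * vIdeal {z ∈ T' | eval z g = 0} ≤
      l.head.asIdeal := by
    refine le_trans (b := vIdeal T') (Ideal.mul_le.mpr fun p hp q hq => ?_) hle
    intro z hz
    have hz0 : eval z f * eval z g = 0 := by simpa using hfg z hz
    rcases mul_eq_zero.mp hz0 with h0 | h0
    · simp [hp z ⟨hz, h0⟩]
    · simp [hq z ⟨hz, h0⟩]
  exact (l.head.isPrime.mul_le.mp hmul).imp (mem_of_le f) (mem_of_le g)

/-- Semicontinuity of the dimension of fibres: if all the fibres of `J` over `T` have dimension at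
least `m`, some `m` of the variables are independent modulo `J` over the generic point of the
closure of `T`. -/
theorem exists_finset_forall_mem_map_eq_zero {K : Type*} [Field K] {n m : ℕ}
    (T : Set (Fin n → K)) (hP : (vIdeal T).IsPrime)
    (J : Ideal (MvPolynomial (Fin n) (MvPolynomial (Fin n) K)))
    (hJ : ∀ z ∈ T, (m : WithBot ℕ∞) ≤
      ringKrullDim (MvPolynomial (Fin n) K ⧸ J.map (map (eval z)))) :
    ∃ S : Finset (Fin n), S.card = m ∧
      ∀ g ∈ J ⊔ RingHom.ker (map (σ := Fin n) (Ideal.Quotient.mk (vIdeal T))),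
        g.vars ⊆ S → map (Ideal.Quotient.mk (vIdeal T)) g = 0 := by
  classical
  by_contra! hcon
  have hcoeff : ∀ S : Finset (Fin n), ∃ r ∉ vIdeal T, S.card = m →
      ∃ g ∈ J ⊔ RingHom.ker (map (σ := Fin n) (Ideal.Quotient.mk (vIdeal T))),
        g.vars ⊆ S ∧ ∃ k, coeff k g = r := by
    intro S
    by_cases hS : S.card = m
    · obtain ⟨g, hg, hvars, hne⟩ := hcon S hS
      obtain ⟨k, hk⟩ := ne_zero_iff.mp hne
      rw [coeff_map] at hk
      exact ⟨coeff k g, fun h => hk (Ideal.Quotient.eq_zero_iff_mem.mpr h), fun _ =>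
        ⟨g, hg, hvars, k, rfl⟩⟩
    · exact ⟨1, (Ideal.ne_top_iff_one _).mp hP.ne_top, fun h => (hS h).elim⟩
  choose r hr hrg using hcoeff
  have hprod : ∏ S, r S ∉ vIdeal T := fun h => by
    obtain ⟨S, -, hS⟩ := hP.prod_mem_iff.mp h
    exact hr S hS
  obtain ⟨z, hz, hzne⟩ : ∃ z ∈ T, eval z (∏ S, r S) ≠ 0 := by
    by_contra! h
    exact hprod h
  obtain ⟨S, hS, hSz⟩ := exists_finset_forall_mem_eq_zero _ (hJ z hz)
  obtain ⟨g, hg, hvars, k, hk⟩ := hrg S hS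
  have hgz : map (eval z) g ∈ J.map (map (eval z)) := by
    obtain ⟨a, ha, b, hb, rfl⟩ := Submodule.mem_sup.mp hg
    have hb0 : map (eval z) b = 0 := by
      ext k
      have : coeff k (map (Ideal.Quotient.mk (vIdeal T)) b) = 0 := by
        rw [RingHom.mem_ker.mp hb, coeff_zero]
      rw [coeff_map, Ideal.Quotient.eq_zero_iff_mem] at this
      rw [coeff_map, coeff_zero]
      exact this z hz
    rw [map_add, hb0, add_zero]
    exact Ideal.mem_map_of_mem _ ha
  have hzero := hSz _ hgz ((vars_map _ _).trans hvars)
  have : eval z (r S) = 0 := by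
    rw [← hk, ← coeff_map, hzero, coeff_zero]
  rw [map_prod] at hzne
  exact hzne (Finset.prod_eq_zero (Finset.mem_univ S) this)

/-- A family of ideals whose fibres over a set of dimension at least `d` have dimension at least
`m` has a point with `m + d` independent coordinates. -/
theorem exists_algebraicIndependent_point.{v} {K : Type v} [Field K] {n m d : ℕ}
    (T : Set (Fin n → K)) (hP : (vIdeal T).IsPrime)
    (hd : (d : WithBot ℕ∞) ≤ ringKrullDim (MvPolynomial (Fin n) K ⧸ vIdeal T))
    (J : Ideal (MvPolynomial (Fin n) (MvPolynomial (Fin n) K)))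
    (hJ : ∀ z ∈ T, (m : WithBot ℕ∞) ≤
      ringKrullDim (MvPolynomial (Fin n) K ⧸ J.map (map (eval z)))) :
    ∃ (E : Type v) (_ : Field E) (_ : Algebra K E) (x z : Fin n → E) (Sx Sz : Finset (Fin n)),
      Sx.card = m ∧ Sz.card = d ∧
      AlgebraicIndependent K (Sum.elim (fun i : Sx => x i) fun i : Sz => z i) ∧
      ∀ g ∈ J, eval₂ (aeval z : MvPolynomial (Fin n) K →ₐ[K] E).toRingHom x g = 0 := by
  classical
  obtain ⟨Sz, hSz, hSzP⟩ := exists_finset_forall_mem_eq_zero _ hd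
  obtain ⟨Sx, hSx, hSxJ⟩ := exists_finset_forall_mem_map_eq_zero T hP J hJ
  let U : Submonoid (MvPolynomial (Fin n) (MvPolynomial (Fin n) K)) :=
    { carrier := {g | g.vars ⊆ Sx ∧ map (Ideal.Quotient.mk (vIdeal T)) g ≠ 0}
      one_mem' := by simp
      mul_mem' := fun {f g} hf hg =>
        ⟨(vars_mul f g).trans (Finset.union_subset hf.1 hg.1), by
          rw [map_mul]; exact mul_ne_zero hf.2 hg.2⟩ }
  obtain ⟨Q, hQ, hJQ, hQU⟩ := Ideal.exists_le_prime_disjoint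
    (J ⊔ RingHom.ker (map (σ := Fin n) (Ideal.Quotient.mk (vIdeal T)))) U
    (Set.disjoint_left.mpr fun g hg hgU => hgU.2 (hSxJ g hg hgU.1))
  let E := FractionRing (MvPolynomial (Fin n) (MvPolynomial (Fin n) K) ⧸ Q)
  let π : MvPolynomial (Fin n) (MvPolynomial (Fin n) K) →ₐ[K] E :=
    (IsScalarTower.toAlgHom K (MvPolynomial (Fin n) (MvPolynomial (Fin n) K) ⧸ Q) E).comp
      (Ideal.Quotient.mkₐ K Q)
  have hπ : ∀ g, π g = 0 ↔ g ∈ Q := fun g => by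
    rw [← Ideal.Quotient.eq_zero_iff_mem]
    exact map_eq_zero_iff _
      (IsFractionRing.injective (MvPolynomial (Fin n) (MvPolynomial (Fin n) K) ⧸ Q) E)
  refine ⟨E, inferInstance, inferInstance, fun i => π (X i), fun i => π (C (X i)), Sx, Sz, hSx,
    hSz, ?_, fun g hg => ?_⟩
  · rw [algebraicIndependent_iff]
    intro p hp
    let ψ : MvPolynomial (Sx ⊕ Sz) K →ₐ[K] MvPolynomial (Fin n) (MvPolynomial (Fin n) K) :=
      ((rename (Subtype.val : Sx → Fin n)).restrictScalars K).comp
        ((mapAlgHom (rename (Subtype.val : Sz → Fin n))).comp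
          (sumAlgEquiv K Sx Sz).toAlgHom)
    have hψ : π.comp ψ =
        aeval (Sum.elim (fun i : Sx => π (X i.1)) fun i : Sz => π (C (X i.1))) := by
      refine algHom_ext fun i => ?_
      rcases i with i | i <;> simp [ψ]
    have hmem : ψ p ∈ Q := (hπ _).mp ((DFunLike.congr_fun hψ p).trans hp)
    have hvars : (ψ p).vars ⊆ Sx := by
      refine (vars_rename _ _).trans ?_
      intro i hi
      obtain ⟨j, -, rfl⟩ := Finset.mem_image.mp hi
      exact j.2
    have hmap : map (Ideal.Quotient.mk (vIdeal T)) (ψ p) = 0 := by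
      by_contra hne
      exact Set.disjoint_left.mp hQU hmem ⟨hvars, hne⟩
    have hq : sumAlgEquiv K Sx Sz p = 0 := by
      ext1 k
      have hk : rename (Subtype.val : Sz → Fin n) (coeff k (sumAlgEquiv K Sx Sz p)) ∈ vIdeal T := by
        have := congrArg (coeff (k.mapDomain Subtype.val)) hmap
        rw [coeff_map, coeff_zero, Ideal.Quotient.eq_zero_iff_mem] at this
        simpa [ψ, coeff_rename_mapDomain _ Subtype.val_injective, coeff_map] using this
      have := hSzP _ hk (by
        refine (vars_rename _ _).trans ?_
        intro i hi
        obtain ⟨j, -, rfl⟩ := Finset.mem_image.mp hi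
        exact j.2)
      rw [coeff_zero]
      exact rename_injective _ Subtype.val_injective (this.trans (map_zero _).symm)
    exact (map_eq_zero_iff _ (sumAlgEquiv K Sx Sz).injective).mp hq
  · have hcomp : eval₂Hom (aeval fun i => π (C (X i)) : MvPolynomial (Fin n) K →ₐ[K] E).toRingHom
        (fun i => π (X i)) = π.toRingHom := by
      refine ringHom_ext' (ringHom_ext (fun a => ?_) fun i => ?_) fun i => ?_
      · simpa using (π.commutes a).symm
      · simp
      · simp
    have := DFunLike.congr_fun hcomp g
    exact this.trans ((hπ g).mpr (hJQ (Ideal.mem_sup_left hg)))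

/-- The universal system `F`, `G`, `G^z` over the ring of polynomials in the coordinates of `z`. -/
noncomputable def genericSystem {K : Type*} [Field K] {n : ℕ} (F G : MvPolynomial (Fin n) K) :
    Fin 3 → MvPolynomial (Fin n) (MvPolynomial (Fin n) K) :=
  ![map C F, map C G, ∑ i, C (X i) * map C (pderiv i G)]

/-- The ideal of the relative singular locus of the universal system `F`, `G`, `G^z`. -/
noncomputable def genericSingIdeal {K : Type*} [Field K] {n : ℕ} (F G : MvPolynomial (Fin n) K) :
    Ideal (MvPolynomial (Fin n) (MvPolynomial (Fin n) K)) :=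
  Ideal.span (Set.range (genericSystem F G) ∪ Set.range fun c : Fin 3 → Fin n =>
    (Matrix.of fun i j => pderiv (c j) (genericSystem F G i)).det)

theorem map_eval_genericSystem {K : Type*} [Field K] {n : ℕ} (F G : MvPolynomial (Fin n) K)
    (z : Fin n → K) (i : Fin 3) :
    map (eval z) (genericSystem F G i) = ![F, G, polY z G] i := by
  have hid : (eval z).comp C = RingHom.id K := RingHom.ext fun a => eval_C a
  fin_cases i
  · simp [genericSystem, map_map, hid, MvPolynomial.map_id]
  · simp [genericSystem, map_map, hid, MvPolynomial.map_id]
  · simp [genericSystem, map_map, hid, MvPolynomial.map_id, polY]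

theorem map_genericSingIdeal_le {K : Type*} [Field K] {n : ℕ} (F G : MvPolynomial (Fin n) K)
    (z : Fin n → K) :
    (genericSingIdeal F G).map (map (eval z)) ≤ singIdeal ![F, G, polY z G] := by
  rw [genericSingIdeal, Ideal.map_span, Ideal.span_le]
  rintro _ ⟨_, ⟨i, rfl⟩ | ⟨c, rfl⟩, rfl⟩
  · rw [map_eval_genericSystem]
    exact Ideal.subset_span (Or.inl ⟨i, rfl⟩)
  · refine Ideal.subset_span (Or.inr ⟨c, ?_⟩)
    rw [jacMinor, RingHom.map_det]
    congr 1
    ext1 i j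
    rw [RingHom.mapMatrix_apply, Matrix.map_apply, Matrix.of_apply, Matrix.of_apply, ← pderiv_map,
      map_eval_genericSystem]

theorem eval₂_aeval_map_C {K E : Type*} [Field K] [Field E] [Algebra K E] {n : ℕ}
    (x z : Fin n → E) (p : MvPolynomial (Fin n) K) :
    eval₂ (aeval z : MvPolynomial (Fin n) K →ₐ[K] E).toRingHom x (map C p) = aeval x p := by
  rw [eval₂_map, aeval_def]
  congr 1
  exact RingHom.ext fun a => by simp

/-- `char K = 0`, `F, G` homogeneous, `deg G ≥ 2`, `n ≥ 3`,
`Y = V(F,G)` a complete intersection of dimension `n-3` (cone dimension `n-2`).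
Let `σ = max {dim Sing Y, dim Sing V(G)}`; write `u = σ + 1`, so that the hypothesis is
that the cones over the two singular loci have dimension `≤ u`. Then for
`-1 ≤ s ≤ n-3` (written `s = t-1`, `0 ≤ t ≤ n-2`), the locus `T_{σ+s+1}(F,G)` of `z`
with `dim Sing V(F,G,G^z) ≥ σ+s+1` (cone dimension `≥ u+t`) satisfies
`dim T_{σ+s+1}(F,G) ≤ n-2-s`, i.e. its cone has dimension `≤ n-t`. -/
theorem statement10 {K : Type*} [Field K] [CharZero K] {n dF e u : ℕ} (hn : 3 ≤ n)
    (he : 2 ≤ e) (F G : MvPolynomial (Fin n) K)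
    (hF : F.IsHomogeneous dF) (hG : G.IsHomogeneous e)
    (hCI : ringKrullDim (MvPolynomial (Fin n) K ⧸ Ideal.span {F, G})
      = ((n - 2 : ℕ) : WithBot ℕ∞))
    (hsY : ringKrullDim (MvPolynomial (Fin n) K ⧸ singIdeal ![F, G]) ≤ (u : WithBot ℕ∞))
    (hsG : ringKrullDim (MvPolynomial (Fin n) K ⧸ singIdeal ![G]) ≤ (u : WithBot ℕ∞)) :
    ∀ t : ℕ, t ≤ n - 2 →
      coneDim {z : Fin n → K |
          ((u + t : ℕ) : WithBot ℕ∞) ≤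
            ringKrullDim (MvPolynomial (Fin n) K ⧸ singIdeal ![F, G, polY z G])}
        ≤ ((n - t : ℕ) : WithBot ℕ∞) := by
  intro t ht
  rcases Nat.eq_zero_or_pos t with rfl | htpos
  · refine (ringKrullDim_quotient_le _).trans ?_
    simp [MvPolynomial.ringKrullDim_of_isNoetherianRing]
  by_contra hlt
  have hdim : ((n - t + 1 : ℕ) : WithBot ℕ∞) ≤ ringKrullDim (MvPolynomial (Fin n) K ⧸
      vIdeal {z : Fin n → K | ((u + t : ℕ) : WithBot ℕ∞) ≤
        ringKrullDim (MvPolynomial (Fin n) K ⧸ singIdeal ![F, G, polY z G])}) := by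
    rw [coneDim, ← ENat.WithBot.lt_add_one_iff] at hlt
    exact_mod_cast not_lt.mp hlt
  obtain ⟨T, hT, hP, hd⟩ := exists_subset_isPrime_vIdeal _ hdim
  obtain ⟨E, _, _, x, z, Sx, Sz, hSx, hSz, hind, hzero⟩ :=
    exists_algebraicIndependent_point T hP hd (genericSingIdeal F G) (m := u + t) fun z hz =>
      (hT hz).trans (ringKrullDim_le_of_surjective
        (Ideal.Quotient.factor (map_genericSingIdeal_le F G z))
        (Ideal.Quotient.factor_surjective _))
  have hsys : ∀ i, eval₂ (aeval z : MvPolynomial (Fin n) K →ₐ[K] E).toRingHom x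
      (genericSystem F G i) = 0 := fun i => hzero _ (Ideal.subset_span (Or.inl ⟨i, rfl⟩))
  have := card_add_card_le_of_algebraicIndependent he F G hG hsY hsG x z
    ((eval₂_aeval_map_C x z F).symm.trans (hsys 0))
    ((eval₂_aeval_map_C x z G).symm.trans (hsys 1)) (fun c => ?_) Sx Sz (by omega) hind
  · omega
  · have hdet := hzero _ (Ideal.subset_span (Or.inr ⟨c, rfl⟩))
    rw [← coe_eval₂Hom, RingHom.map_det] at hdet
    rw [← hdet]
    congr 1
    ext i j
    rw [RingHom.mapMatrix_apply, Matrix.map_apply, Matrix.of_apply, coe_eval₂Hom]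
    have hC : ((aeval z : MvPolynomial (Fin n) K →ₐ[K] E) : MvPolynomial (Fin n) K →+* E).comp C =
        algebraMap K E := RingHom.ext fun a => by simp
    fin_cases i
    · simp [genericSystem, pderiv_map, hC, aeval_def]
    · simp [genericSystem, pderiv_map, hC, aeval_def]
    · simp [genericSystem, pderiv_map, hC, aeval_def, eval₂_sum, Derivation.leibniz]
end
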